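/- Let H be a standard (1,1) diagram and s a class of intersection points such that the points of α̃ ∩ β̃_s occupy consecutive Maslov gradings with multiplicities, listed from highest to lowest grading, of the form (∗,∗,1) or (∗,∗,2,1), where each ∗ is a positive integer. Then the unique point of α̃ ∩ β̃_s with the lowest Maslov grading has both a predecessor and a successor along β̃_s. (This is the content of Lemma 3.7 of the paper, with the Floer-theoretic hypothesis replaced by the grading multiplicity condition it implies.) -/

import Mathlib

/-!
Common combinatorial framework for standard (1,1) diagrams in Rasmussen standard
form, their lifts to the universal cover of the torus, and the combinatorial knot
Floer chain complexes they define.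
-/

namespace OneOneKnot

open scoped Classical

noncomputable section

/-- A state in the traversal of the lifts of the `β` curve of a standard (1,1) diagram
to the universal cover `ℝ²` of the torus.  `pos` is the position coordinate of an
intersection point of `β` with a lift of `α`; `up` records whether `β` crosses that
lift of `α` upwards (with respect to the reference orientation of `β`); `top` records
whether `pos` is measured as a top-edge or a bottom-edge coordinate of the
corresponding fundamental rectangle; `ht` is the index of the lift of `α` (the line
`y = ht`). -/
structure CState where
  pos : ℤ
  up : Bool
  top : Bool
  ht : ℤ

/-- The data of a standard (1,1) diagram in Rasmussen standard form, encoded by a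
four-tuple `(p, q, r, s)` with `q, r ≥ 0`, `2q + r ≤ p` and `0 ≤ s < p`. -/
structure StdDiagram where
  p : ℕ
  q : ℕ
  r : ℕ
  s : ℕ
  hp : 0 < p
  h2qr : 2 * q + r ≤ p
  hs : s < p

namespace StdDiagram

variable (D : StdDiagram)

def pz : ℤ := D.p
def qz : ℤ := D.q
def rz : ℤ := D.r
def sz : ℤ := D.s

/-- One step forward along (a lift of) `β`, with respect to a reference orientation of
`β`.  This is Algorithm 1 of the paper: rainbow arcs occupy top-edge positions
`r, …, r + 2q - 1` and bottom-edge positions `0, …, 2q - 1` (mod `p`), the `i`-th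
point of the top edge is identified with the `(i+s)`-th point of the bottom edge, and
`ht` records the line `y = ht` of the universal cover on which the point lies. -/
def step (σ : CState) : CState :=
  let m := σ.pos % D.pz
  if σ.top then
    if σ.up then ⟨σ.pos + D.sz, σ.up, false, σ.ht⟩
    else if m ≤ D.rz - 1 then ⟨σ.pos + 2 * D.qz, σ.up, false, σ.ht - 1⟩
    else if m ≤ D.rz + 2 * D.qz - 1 then
      ⟨2 * D.rz + 2 * D.qz - 1 - 2 * m + σ.pos, true, true, σ.ht⟩
    else ⟨σ.pos, σ.up, false, σ.ht - 1⟩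
  else
    if σ.up = false then ⟨σ.pos - D.sz, σ.up, true, σ.ht⟩
    else if m ≤ 2 * D.qz - 1 then ⟨2 * D.qz - 1 - 2 * m + σ.pos, false, false, σ.ht⟩
    else if m ≤ D.rz + 2 * D.qz - 1 then ⟨σ.pos - 2 * D.qz, σ.up, true, σ.ht + 1⟩
    else ⟨σ.pos, σ.up, true, σ.ht + 1⟩

/-- One step backward along `β` (the inverse of `step`). -/
def stepB (σ : CState) : CState :=
  let m := σ.pos % D.pz
  if σ.top then
    if σ.up then
      if D.rz ≤ m ∧ m ≤ D.rz + 2 * D.qz - 1 then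
        ⟨2 * D.rz + 2 * D.qz - 1 - 2 * m + σ.pos, false, true, σ.ht⟩
      else if m ≤ D.rz - 1 then ⟨σ.pos + 2 * D.qz, true, false, σ.ht - 1⟩
      else ⟨σ.pos, true, false, σ.ht - 1⟩
    else ⟨σ.pos + D.sz, false, false, σ.ht⟩
  else
    if σ.up then ⟨σ.pos - D.sz, true, true, σ.ht⟩
    else
      if m ≤ 2 * D.qz - 1 then ⟨2 * D.qz - 1 - 2 * m + σ.pos, true, false, σ.ht⟩
      else if m ≤ 2 * D.qz + D.rz - 1 then ⟨σ.pos - 2 * D.qz, false, true, σ.ht + 1⟩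
      else ⟨σ.pos, false, true, σ.ht + 1⟩

/-- Reference starting state: the intersection point with top-edge coordinate `0`
on the line `y = 0`. -/
def start0 : CState := ⟨0, false, true, 0⟩

/-- `β` is a single closed curve: its traversal passes through all `p`
intersection points with `α`. -/
def Connected : Prop :=
  ∀ k : ℕ, k < D.p → ∃ n : ℕ,
    ((D.step)^[n] start0).top = true ∧ ((D.step)^[n] start0).pos % D.pz = (k : ℤ)

/-- `β` crosses the intersection point with top-edge coordinate `≡ k (mod p)`
upwards, with respect to the reference orientation of `β`. -/
def UpAt (k : ℤ) : Prop :=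
  ∃ n : ℕ, ((D.step)^[n] start0).top = true ∧
    ((D.step)^[n] start0).pos % D.pz = k % D.pz ∧ ((D.step)^[n] start0).up = true

/-- The algebraic intersection number `α · β` computed with the reference
orientation of `β` (and `α` oriented from left to right). -/
def algInt : ℤ := ∑ k ∈ Finset.range D.p, (if D.UpAt (k : ℤ) then (1 : ℤ) else -1)

/-- One step forward along `β` for the orientation of `β` normalised so that
`α · β > 0`. -/
def fstep (σ : CState) : CState := if 0 < D.algInt then D.step σ else D.stepB σ

/-- With the normalised orientation, `β` crosses `α` upwards at the given state. -/
def TrueUp (σ : CState) : Prop := (0 < D.algInt ↔ σ.up = true)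

/-- With the normalised orientation, `β` crosses the intersection point with
top-edge coordinate `≡ k (mod p)` upwards. -/
def TrueUpPt (k : ℤ) : Prop := (0 < D.algInt ↔ D.UpAt k)

/-- The canonical state sitting at the intersection point `k` on the line `y = 0`
(of the chosen lift `α̃` of `α`). -/
def spt (k : ℕ) : CState := ⟨(k : ℤ), if D.UpAt (k : ℤ) then true else false, true, 0⟩

/-- The state is an intersection point of `β̃` with the line `y = 0`
(recorded with its canonical top-edge coordinate). -/
def IsCross0 (σ : CState) : Prop := σ.top = true ∧ σ.ht = 0

/-- The portion of `β̃` after `σ` returns to the line `y = 0`; that is, `σ` is the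
starting point of a compact arc cut off by `α̃` rather than of a ray. -/
def Returns0 (σ : CState) : Prop := ∃ n : ℕ, 1 ≤ n ∧ IsCross0 ((D.fstep)^[n] σ)

/-- Number of `fstep`-moves until the next intersection with the line `y = 0`. -/
def ret0Steps (σ : CState) : ℕ := sInf {n : ℕ | 1 ≤ n ∧ IsCross0 ((D.fstep)^[n] σ)}

/-- The next intersection point of `β̃` with the line `y = 0` after `σ`. -/
def nxt0 (σ : CState) : CState := (D.fstep)^[D.ret0Steps σ] σ

/-- The label (downstairs intersection point) of a state. -/
def lab (σ : CState) : ℤ := σ.pos % D.pz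

/-- The compact arc of `β̃` starting at the intersection point `k` of the line
`y = 0` is oriented rightward (for the normalised orientation of `β`). -/
def ArcRight (k : ℕ) : Prop := (k : ℤ) < (D.nxt0 (D.spt k)).pos

/-- Starting points of the compact arcs in the upper half-plane cut off by `α̃`
from the union of the lifts `β̃ₛ`. -/
def UpperStarts : Finset ℕ :=
  (Finset.range D.p).filter fun k => D.Returns0 (D.spt k) ∧ D.TrueUp (D.spt k)

/-- Starting points of the compact arcs in the lower half-plane. -/
def LowerStarts : Finset ℕ :=
  (Finset.range D.p).filter fun k => D.Returns0 (D.spt k) ∧ ¬ D.TrueUp (D.spt k)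

/-- The number of compact arcs in the upper half-plane with orientation `b`
(`true` = rightward, `false` = leftward). -/
def uCnt (b : Bool) : ℕ := (D.UpperStarts.filter fun k => D.ArcRight k ↔ b = true).card

/-- The number of compact arcs in the lower half-plane with orientation `b`. -/
def lCnt (b : Bool) : ℕ := (D.LowerStarts.filter fun k => D.ArcRight k ↔ b = true).card

/-- Definition 3.2: the standard diagram is *virtually almost coherent* if, for an
admissible choice of inconsistent direction in each half-plane (the inconsistent
direction must be carried by at most as many arcs as the other direction), the
union of the lifts `β̃ₛ` contains exactly two inconsistent arcs. -/
def VirtuallyAlmostCoherent : Prop :=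
  ∃ dU dL : Bool,
    D.uCnt dU ≤ D.uCnt (!dU) ∧ D.lCnt dL ≤ D.lCnt (!dL) ∧ D.uCnt dU + D.lCnt dL = 2

/-- `k` is the starting point of one of the two inconsistent arcs, for the choice
`(dU, dL)` of inconsistent directions in the upper and lower half-planes. -/
def InconsCoverArc (dU dL : Bool) (k : ℕ) : Prop :=
  (k ∈ D.UpperStarts ∧ (D.ArcRight k ↔ dU = true)) ∨
  (k ∈ D.LowerStarts ∧ (D.ArcRight k ↔ dL = true))

/-! ### Rainbow arcs of the diagram downstairs -/

/-- The rainbow arcs of the standard diagram: `(true, i)` with `r ≤ i < r + q` is the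
rainbow arc attached to the top edge with feet `i` and `2r + 2q - 1 - i`; `(false, j)`
with `j < q` is the rainbow arc attached to the bottom edge with feet `j` and
`2q - 1 - j`.  The two families are the rainbow arcs around the two basepoints. -/
def rainbowArcs : Finset (Bool × ℕ) :=
  ((Finset.Ico D.r (D.r + D.q)).image fun i => ((true : Bool), i)) ∪
    ((Finset.range D.q).image fun j => ((false : Bool), j))

/-- The two endpoints of a rainbow arc, as intersection points of `α ∩ β` recorded
by their top-edge coordinates in `ZMod p`. -/
def rEnds (a : Bool × ℕ) : Finset (ZMod D.p) :=
  if a.1 then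
    {((a.2 : ℤ) : ZMod D.p), ((2 * D.rz + 2 * D.qz - 1 - (a.2 : ℤ) : ℤ) : ZMod D.p)}
  else
    {(((a.2 : ℤ) - D.sz : ℤ) : ZMod D.p), ((2 * D.qz - 1 - (a.2 : ℤ) - D.sz : ℤ) : ZMod D.p)}

/-- A rainbow arc is oriented rightward (with the normalised orientation of `β`):
a top-edge rainbow arc is traversed starting from the endpoint where `β` crosses `α`
downwards, a bottom-edge one from the endpoint where `β` crosses `α` upwards. -/
def rOrientRight (a : Bool × ℕ) : Prop :=
  if a.1 then ¬ D.TrueUpPt (a.2 : ℤ) else D.TrueUpPt ((a.2 : ℤ) - D.sz)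

/-- The number of rainbow arcs in the family `f` (`true` = attached to the top edge)
with orientation `b` (`true` = rightward). -/
def famCnt (f : Bool) (b : Bool) : ℕ :=
  (D.rainbowArcs.filter fun a => a.1 = f ∧ (D.rOrientRight a ↔ b = true)).card

/-- `a` is an inconsistent rainbow arc for the choice `(dT, dB)` of inconsistent
directions for the two families. -/
def InconsArc (dT dB : Bool) (a : Bool × ℕ) : Prop :=
  a ∈ D.rainbowArcs ∧ (D.rOrientRight a ↔ (if a.1 then dT else dB) = true)

/-- Two rainbow arcs share a common endpoint. -/
def ShareEnd (a b : Bool × ℕ) : Prop := ((D.rEnds a) ∩ (D.rEnds b)).Nonempty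

/-- Two rainbow arcs are connected to each other by two other rainbow arcs. -/
def ConnectedByTwo (a1 a2 : Bool × ℕ) : Prop :=
  ∃ b1 b2 : Bool × ℕ, b1 ∈ D.rainbowArcs ∧ b2 ∈ D.rainbowArcs ∧
    b1 ≠ a1 ∧ b1 ≠ a2 ∧ b2 ≠ a1 ∧ b2 ≠ a2 ∧ b1 ≠ b2 ∧
    D.ShareEnd a1 b1 ∧ D.ShareEnd b1 b2 ∧ D.ShareEnd b2 a2

/-- Definition 1.2: the standard diagram is *strongly almost coherent* if, for an
admissible choice of inconsistent directions, there are exactly two inconsistent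
rainbow arcs, and either they share a common endpoint, or they are connected to each
other by two other rainbow arcs. -/
def StronglyAlmostCoherent : Prop :=
  ∃ dT dB : Bool,
    D.famCnt true dT ≤ D.famCnt true (!dT) ∧ D.famCnt false dB ≤ D.famCnt false (!dB) ∧
    ∃ a1 a2 : Bool × ℕ, a1 ≠ a2 ∧ (∀ a, D.InconsArc dT dB a ↔ (a = a1 ∨ a = a2)) ∧
      (D.ShareEnd a1 a2 ∨ D.ConnectedByTwo a1 a2)

/-! ### Spin^c classes of intersection points -/

/-- The point `l` is reached from the point `k` by travelling forward along the lift
`β̃` through (the lift at height `0` of) `k`, meeting it on the line `y = 0`. -/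
def Reach (k l : ℕ) : Prop :=
  ∃ n : ℕ, IsCross0 ((D.fstep)^[n] (D.spt k)) ∧
    ((D.fstep)^[n] (D.spt k)).pos % D.pz = (l : ℤ)

/-- Two intersection points are in the same class (i.e. they induce the same
spin^c structure): some lift of `β` meeting the line `y = 0` passes through lifts
of both of them on that line. -/
def SameClass (k l : ℕ) : Prop := D.Reach k l ∨ D.Reach l k

/-! ### The sequence of intersection points along a lift -/

/-- The `m`-th intersection point of `β̃ₛ` with the line `y = 0` after the point `c`. -/
def seqSt (c m : ℕ) : CState := (D.nxt0)^[m] (D.spt c)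

/-- Its label downstairs. -/
def labAt (c m : ℕ) : ℤ := D.lab (D.seqSt c m)

/-- Its position coordinate on the line `y = 0`. -/
def posAt (c m : ℕ) : ℤ := (D.seqSt c m).pos

/-- The differential component carried by the compact arc starting at `k` points
from the starting point of the arc towards its end point.  (For an arc in the upper
half-plane the source of the arrow is the right endpoint, for an arc in the lower
half-plane it is the left endpoint.) -/
def srcIsStart (k : ℕ) : Prop :=
  ¬ (D.TrueUp (D.spt k) ↔ (k : ℤ) < (D.nxt0 (D.spt k)).pos)

/-- The label of the source of the differential component carried by the arc
starting at `k`. -/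
def srcLab (k : ℕ) : ℤ :=
  if D.srcIsStart k then (k : ℤ) % D.pz else (D.nxt0 (D.spt k)).pos % D.pz

/-- The label of the target of the differential component carried by the arc
starting at `k`. -/
def tgtLab (k : ℕ) : ℤ :=
  if D.srcIsStart k then (D.nxt0 (D.spt k)).pos % D.pz else (k : ℤ) % D.pz

/-- The number of bigons (compact arcs) inducing a differential component from `x`
to `y`. -/
def arrowCnt (x y : ℕ) : ℕ :=
  ((Finset.range D.p).filter fun k =>
    D.Returns0 (D.spt k) ∧ D.srcLab k = (x : ℤ) ∧ D.tgtLab k = (y : ℤ)).card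


/-! ### Counting basepoints inside the bigon cut off by a compact arc -/

/-- Doubled plane `x`-coordinate of a state in the (sheared) universal cover. -/
def x2 (σ : CState) : ℤ := 2 * σ.pos - 2 * D.sz * (if σ.top then σ.ht - 1 else σ.ht)

/-- The number of crossings of the upward vertical ray emanating from the basepoint
slot in row `ρ` with doubled `x`-coordinate `X0` (a `w`-slot if `isZ = false`, sitting
just above the line `y = ρ`; a `z`-slot if `isZ = true`, sitting just below the line
`y = ρ + 1`) with the piece of `β̃` between the state `σ` and the next state. -/
def rayCross (σ : CState) (X0 ρ : ℤ) (isZ : Bool) : ℕ :=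
  let σ' := D.fstep σ
  let lo := min (D.x2 σ) (D.x2 σ')
  let hi := max (D.x2 σ) (D.x2 σ')
  if σ.ht ≠ σ'.ht then
    -- a strand crossing the row between the lines `y = min ht` and `y = min ht + 1`
    (if (ρ < min σ.ht σ'.ht ∨ (ρ = min σ.ht σ'.ht ∧ isZ = false)) ∧ lo < X0 ∧ X0 < hi
      then 1 else 0)
  else if σ.top = σ'.top then
    if σ.top then
      -- a rainbow arch hanging below the line `y = σ.ht`
      (if (if isZ then ρ ≤ σ.ht - 2 else ρ ≤ σ.ht - 1) ∧ lo < X0 ∧ X0 < hi then 1 else 0)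
    else
      -- a rainbow arch sitting above the line `y = σ.ht`
      (if (if isZ then ρ ≤ σ.ht - 1 else ρ ≤ σ.ht) ∧ lo < X0 ∧ X0 < hi then 1 else 0)
  else 0

/-- Doubled plane `x`-coordinate of the basepoint slot of row `ρ`, horizontal
translate `m`: the `w`-basepoint is between bottom-edge coordinates `q - 1` and `q`,
the `z`-basepoint between top-edge coordinates `r + q - 1` and `r + q`. -/
def slotX2 (ρ m : ℤ) (isZ : Bool) : ℤ :=
  (if isZ then 2 * (D.rz + D.qz) - 1 else 2 * D.qz - 1) - 2 * ρ * D.sz + 2 * m * D.pz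

/-- The states traversed by the compact arc starting at the intersection point `k`. -/
def arcState (k i : ℕ) : CState := (D.fstep)^[i] (D.spt k)

/-- Number of crossings of the upward vertical ray from a slot with the chord of the
bigon (the segment of the line `y = 0` joining the endpoints of the arc). -/
def chordCross (k : ℕ) (X0 ρ : ℤ) : ℕ :=
  if ρ ≤ -1 ∧ min (D.x2 (D.spt k)) (D.x2 (D.nxt0 (D.spt k))) < X0 ∧
      X0 < max (D.x2 (D.spt k)) (D.x2 (D.nxt0 (D.spt k))) then 1 else 0

/-- A basepoint slot lies inside the (embedded) bigon cobounded by the compact arc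
starting at `k` and the line `y = 0`: the upward vertical ray from the slot meets the
boundary of the bigon an odd number of times. -/
def SlotInBigon (k : ℕ) (ρ m : ℤ) (isZ : Bool) : Prop :=
  ¬ (2 ∣ ((D.chordCross k (D.slotX2 ρ m isZ) ρ : ℤ) +
      ∑ i ∈ Finset.range (D.ret0Steps (D.spt k)),
        (D.rayCross (D.arcState k i) (D.slotX2 ρ m isZ) ρ isZ : ℤ)))

/-- A bound for the rows met by the arc starting at `k`. -/
def hBound (k : ℕ) : ℕ :=
  ((Finset.range (D.ret0Steps (D.spt k) + 1)).sup fun i => (D.arcState k i).ht.natAbs) + 2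

/-- A bound for the horizontal translates of slots met by the arc starting at `k`. -/
def mBound (k : ℕ) : ℕ :=
  ((Finset.range (D.ret0Steps (D.spt k) + 1)).sup fun i => (D.arcState k i).pos.natAbs)
    + (D.hBound k + 2) * (D.s + 1) + D.p + D.q + D.r + 4

/-- The number of lifts of the `w`-basepoint (`isZ = false`), respectively of the
`z`-basepoint (`isZ = true`), inside the bigon cobounded by the compact arc starting
at `k` and the line `y = 0`. -/
def arcBase (k : ℕ) (isZ : Bool) : ℕ :=
  (((Finset.Icc (-(D.hBound k : ℤ)) (D.hBound k)) ×ˢ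
      (Finset.Icc (-(D.mBound k : ℤ)) (D.mBound k))).filter
    fun ρm => D.SlotInBigon k ρm.1 ρm.2 isZ).card

/-- The arc starting at `k` stays within the two rows adjacent to the line `y = 0`
(equivalently, it has height `< 1`). -/
def ArcWithinRow (k : ℕ) : Prop :=
  ∀ n : ℕ, n ≤ D.ret0Steps (D.spt k) → (D.arcState k n).ht = 0

/-- The arc starting at `k` is a lift of a single rainbow arc of the diagram. -/
def ArcIsRainbowLift (k : ℕ) : Prop := D.ret0Steps (D.spt k) = 3

/-! ### Gradings and filtrations of the knot Floer complex -/

/-- The relative Maslov grading changes by `±1` along each arc, dropping (by `1`)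
from the source of its differential component to the target. -/
def grStep (k : ℕ) : ℤ := if D.srcIsStart k then -1 else 1

/-- The relative `i`-filtration drops, from the source of the differential component
carried by an arc to the target, by the number of `w`-basepoints in its bigon. -/
def faStep (k : ℕ) : ℤ := (if D.srcIsStart k then -1 else 1) * (D.arcBase k false : ℤ)

/-- The relative `j`-filtration drops by the number of `z`-basepoints in the bigon. -/
def fbStep (k : ℕ) : ℤ := (if D.srcIsStart k then -1 else 1) * (D.arcBase k true : ℤ)

/-- The sum of the per-arc increments of a relative grading along the first `m` arcs
of the lift `β̃` starting at the point `c`. -/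
def pathSum (f : ℕ → ℤ) (c m : ℕ) : ℤ := ∑ i ∈ Finset.range m, f (D.labAt c i).toNat

/-- `a` occurs in the forward sequence of intersection points of `β̃` with the line
`y = 0` starting at `c`. -/
def ReachIn (c a : ℕ) : Prop := ∃ m : ℕ, D.labAt c m = (a : ℤ)

/-- The value at `a` of the relative grading with per-arc increments `f`, normalised
to vanish at the base point `c` of the class. -/
def relOf (f : ℕ → ℤ) (c a : ℕ) : ℤ :=
  if h : D.ReachIn c a then D.pathSum f c (Nat.find h)
  else if h' : D.ReachIn a c then - D.pathSum f a (Nat.find h') else 0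

/-- The Maslov grading of the generator `a` of the class of `c` (normalised at `c`). -/
def grOf (c a : ℕ) : ℤ := D.relOf D.grStep c a

/-- The `i`-filtration of the generator `a` of the class of `c`. -/
def faOf (c a : ℕ) : ℤ := D.relOf D.faStep c a

/-- The `j`-filtration of the generator `a` of the class of `c`. -/
def fbOf (c a : ℕ) : ℤ := D.relOf D.fbStep c a

/-- The number of generators of the class of `c` in Maslov grading `g`. -/
def grCountClass (c : ℕ) (g : ℤ) : ℕ :=
  ((Finset.range D.p).filter fun a => D.SameClass a c ∧ D.grOf c a = g).card

/-! ### Turning points -/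

/-- The differential component of the arc from the `i`-th to the `(i+1)`-st point of
the sequence along `β̃ₛ` starting at `c` points forward. -/
def srcIsStartAt (c i : ℕ) : Prop := D.srcIsStart (D.labAt c i).toNat

/-- The cumulative relative Maslov grading of the `m`-th point of the sequence along
`β̃ₛ` starting at `c`. -/
def grPartial (c m : ℕ) : ℤ :=
  ∑ i ∈ Finset.range m, (if D.srcIsStartAt c i then (-1 : ℤ) else 1)

/-- The `m`-th point of the sequence along `β̃ₛ` starting at `c` is a *turning point*:
its position on the line `y = 0` is either greater or smaller than the positions of
both its predecessor and its successor. -/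
def TurningAt (c m : ℕ) : Prop :=
  1 ≤ m ∧ ((D.posAt c (m - 1) < D.posAt c m ∧ D.posAt c (m + 1) < D.posAt c m) ∨
    (D.posAt c m < D.posAt c (m - 1) ∧ D.posAt c m < D.posAt c (m + 1)))

/-- A *positive* turning point: its predecessor appears in its differential. -/
def PosTurningAt (c m : ℕ) : Prop := D.TurningAt c m ∧ ¬ D.srcIsStartAt c (m - 1)

/-- A *negative* turning point: it appears in the differential of its predecessor. -/
def NegTurningAt (c m : ℕ) : Prop := D.TurningAt c m ∧ D.srcIsStartAt c (m - 1)

end StdDiagram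

/-! ### Bifiltered complexes over 𝔽₂ -/

/-- A based, bifiltered, Maslov-graded complex over `𝔽₂ = ZMod 2`:  `d x y` is the
coefficient of the basis element `y` in the differential of the basis element `x`,
`gr` is the Maslov grading and `(fa, fb)` the `(i, j)`-bifiltration levels of the
basis elements. -/
structure BFC where
  ι : Type
  fin : Fintype ι
  dec : DecidableEq ι
  d : ι → ι → ZMod 2
  gr : ι → ℤ
  fa : ι → ℤ
  fb : ι → ℤ

attribute [instance] BFC.fin BFC.dec

namespace BFC

/-- The dual of a bifiltered complex. -/
def dual (C : BFC) : BFC :=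
  ⟨C.ι, C.fin, C.dec, fun u v => C.d v u, fun u => - C.gr u, fun u => - C.fa u,
    fun u => - C.fb u⟩

/-- The subcomplex (of a direct summand) spanned by the basis elements selected
by `S`. -/
def sub (C : BFC) (S : C.ι → Bool) : BFC where
  ι := {u : C.ι // S u = true}
  fin := Subtype.fintype _
  dec := Classical.decEq _
  d u v := C.d u.1 v.1
  gr u := C.gr u.1
  fa u := C.fa u.1
  fb u := C.fb u.1

/-- The number of basis elements in Maslov grading `g`. -/
def grCount (C : BFC) (g : ℤ) : ℕ := (Finset.univ.filter fun u : C.ι => C.gr u = g).card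

end BFC

/-- Definition 2.1: a positive staircase with `2N + 1` generators
`y₁, x₁, y₂, x₂, …, y_{N+1}` (even positions along the zigzag are the `y`'s, odd
positions the `x`'s), with `∂ xₗ = yₗ + y_{ℓ+1}`, `∂ yₗ = 0`, where consecutive
generators differ in only one of the two filtration coordinates, alternately. -/
def IsPosStaircaseOf (N : ℕ) (C : BFC) : Prop :=
  ∃ (e : Fin (2 * N + 1) ≃ C.ι) (f : Bool),
    (∀ k l : Fin (2 * N + 1), C.d (e k) (e l) =
      if k.1 % 2 = 1 ∧ (k.1 = l.1 + 1 ∨ l.1 = k.1 + 1) then 1 else 0) ∧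
    (∀ k l : Fin (2 * N + 1), l.1 = k.1 + 1 →
      (C.gr (e l) = C.gr (e k) + (if k.1 % 2 = 0 then 1 else -1)) ∧
      (if decide (k.1 % 2 = 0) = f then
        C.fb (e k) = C.fb (e l) ∧
          (if k.1 % 2 = 0 then C.fa (e k) < C.fa (e l) else C.fa (e l) < C.fa (e k))
      else
        C.fa (e k) = C.fa (e l) ∧
          (if k.1 % 2 = 0 then C.fb (e k) < C.fb (e l) else C.fb (e l) < C.fb (e k))))

/-- A positive staircase (of any length). -/
def IsPosStaircase (C : BFC) : Prop := ∃ N : ℕ, IsPosStaircaseOf N C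

/-- A negative staircase is the dual of a positive staircase. -/
def IsNegStaircase (C : BFC) : Prop := IsPosStaircase C.dual

/-- A staircase: a positive or a negative staircase. -/
def IsStaircase (C : BFC) : Prop := IsPosStaircase C ∨ IsNegStaircase C

/-- A staircase of given sign (`true` = positive). -/
def IsSignedStaircase (b : Bool) (C : BFC) : Prop :=
  if b then IsPosStaircase C else IsNegStaircase C

/-- A box of length 1: generators `a, b, c, d` at bifiltration levels
`(0,0), (0,1), (1,0), (1,1)` (up to an overall shift), with `∂d = b + c`,
`∂b = ∂c = a`, `∂a = 0`. -/
def IsBox (C : BFC) : Prop :=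
  ∃ (e : Fin 4 ≃ C.ι) (a0 b0 g0 : ℤ),
    C.fa (e 0) = a0 ∧ C.fb (e 0) = b0 ∧ C.gr (e 0) = g0 ∧
    C.fa (e 1) = a0 ∧ C.fb (e 1) = b0 + 1 ∧ C.gr (e 1) = g0 + 1 ∧
    C.fa (e 2) = a0 + 1 ∧ C.fb (e 2) = b0 ∧ C.gr (e 2) = g0 + 1 ∧
    C.fa (e 3) = a0 + 1 ∧ C.fb (e 3) = b0 + 1 ∧ C.gr (e 3) = g0 + 2 ∧
    (∀ k l : Fin 4, C.d (e k) (e l) =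
      if (k = 3 ∧ (l = 1 ∨ l = 2)) ∨ ((k = 1 ∨ k = 2) ∧ l = 0) then 1 else 0)

/-- `C` is the direct sum of a complex satisfying `P1` and one satisfying `P2`. -/
def IsDirectSumOf (C : BFC) (P1 P2 : BFC → Prop) : Prop :=
  ∃ S : C.ι → Bool, (∀ u v : C.ι, S u ≠ S v → C.d u v = 0) ∧
    P1 (C.sub S) ∧ P2 (C.sub fun u => ! S u)

/-- Definition 2.3 (a): a positive almost staircase of type (a), with generators
`x₁, …, x_{2k}`, `y₁, …, y_{2k+1}`, `y'_{k+1}` and `z`. -/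
def IsPosAlmostStairA (C : BFC) : Prop :=
  ∃ k : ℕ, 1 ≤ k ∧ ∃ (X Y : ℕ → C.ι) (y' z : C.ι) (a0 b0 : ℤ),
    Fintype.card C.ι = 4 * k + 3 ∧
    (∀ u : C.ι, u = y' ∨ u = z ∨ (∃ ℓ, 1 ≤ ℓ ∧ ℓ ≤ 2 * k ∧ u = X ℓ) ∨
      (∃ ℓ, 1 ≤ ℓ ∧ ℓ ≤ 2 * k + 1 ∧ u = Y ℓ)) ∧
    (∀ u v : C.ι, C.d u v ≠ 0 → C.gr u = C.gr v + 1) ∧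
    C.fa (Y (k + 1)) = a0 ∧ C.fb (Y (k + 1)) = b0 + 1 ∧
    C.fa y' = a0 + 1 ∧ C.fb y' = b0 ∧ C.fa z = a0 ∧ C.fb z = b0 ∧
    (∀ ℓ, 1 ≤ ℓ → ℓ ≤ 2 * k → C.fb (X ℓ) = C.fb (Y ℓ) ∧ C.fa (Y ℓ) < C.fa (X ℓ)) ∧
    (∀ ℓ, 1 ≤ ℓ → ℓ ≤ 2 * k → ℓ ≠ k →
      C.fa (X ℓ) = C.fa (Y (ℓ + 1)) ∧ C.fb (Y (ℓ + 1)) < C.fb (X ℓ)) ∧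
    (C.fa (X k) = C.fa y' ∧ C.fb y' < C.fb (X k)) ∧
    (∀ ℓ, 1 ≤ ℓ → ℓ ≤ 2 * k → ℓ ≠ k → ℓ ≠ k + 1 →
      ∀ v, C.d (X ℓ) v = if v = Y ℓ ∨ v = Y (ℓ + 1) then 1 else 0) ∧
    (∀ v, C.d (X k) v = if v = Y k ∨ v = Y (k + 1) ∨ v = y' then 1 else 0) ∧
    (∀ v, C.d (X (k + 1)) v = if v = Y (k + 1) ∨ v = Y (k + 2) ∨ v = y' then 1 else 0) ∧
    (∀ v, C.d (Y (k + 1)) v = if v = z then 1 else 0) ∧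
    (∀ v, C.d y' v = if v = z then 1 else 0) ∧
    (∀ ℓ, 1 ≤ ℓ → ℓ ≤ 2 * k + 1 → ℓ ≠ k + 1 → ∀ v, C.d (Y ℓ) v = 0) ∧
    (∀ v, C.d z v = 0)

/-- Definition 2.3 (b): a positive almost staircase of type (b), with generators
`x₁, …, x_{2k+1}`, `x'_{k+1}`, `y₁, …, y_{2k+2}` and `z`. -/
def IsPosAlmostStairB (C : BFC) : Prop :=
  ∃ k : ℕ, 1 ≤ k ∧ ∃ (X Y : ℕ → C.ι) (x' z : C.ι) (a0 b0 : ℤ),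
    Fintype.card C.ι = 4 * k + 5 ∧
    (∀ u : C.ι, u = x' ∨ u = z ∨ (∃ ℓ, 1 ≤ ℓ ∧ ℓ ≤ 2 * k + 1 ∧ u = X ℓ) ∨
      (∃ ℓ, 1 ≤ ℓ ∧ ℓ ≤ 2 * k + 2 ∧ u = Y ℓ)) ∧
    (∀ u v : C.ι, C.d u v ≠ 0 → C.gr u = C.gr v + 1) ∧
    C.fa (X (k + 1)) = a0 ∧ C.fb (X (k + 1)) = b0 - 1 ∧
    C.fa x' = a0 - 1 ∧ C.fb x' = b0 ∧ C.fa z = a0 ∧ C.fb z = b0 ∧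
    (∀ ℓ, 1 ≤ ℓ → ℓ ≤ 2 * k + 1 → C.fb (X ℓ) = C.fb (Y ℓ) ∧ C.fa (Y ℓ) < C.fa (X ℓ)) ∧
    (∀ ℓ, 1 ≤ ℓ → ℓ ≤ 2 * k + 1 → ℓ ≠ k + 1 →
      C.fa (X ℓ) = C.fa (Y (ℓ + 1)) ∧ C.fb (Y (ℓ + 1)) < C.fb (X ℓ)) ∧
    (C.fa x' = C.fa (Y (k + 2)) ∧ C.fb (Y (k + 2)) < C.fb x') ∧
    (∀ ℓ, 1 ≤ ℓ → ℓ ≤ 2 * k + 1 → ℓ ≠ k + 1 →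
      ∀ v, C.d (X ℓ) v = if v = Y ℓ ∨ v = Y (ℓ + 1) then 1 else 0) ∧
    (∀ v, C.d z v = if v = X (k + 1) ∨ v = x' then 1 else 0) ∧
    (∀ v, C.d (X (k + 1)) v = if v = Y (k + 1) ∨ v = Y (k + 2) then 1 else 0) ∧
    (∀ v, C.d x' v = if v = Y (k + 1) ∨ v = Y (k + 2) then 1 else 0) ∧
    (∀ ℓ, 1 ≤ ℓ → ℓ ≤ 2 * k + 2 → ∀ v, C.d (Y ℓ) v = 0)

/-- A positive almost staircase. -/
def IsPosAlmostStaircase (C : BFC) : Prop := IsPosAlmostStairA C ∨ IsPosAlmostStairB C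

/-- A negative almost staircase is the dual of a positive almost staircase. -/
def IsNegAlmostStaircase (C : BFC) : Prop := IsPosAlmostStaircase C.dual

/-- `C'` is obtained from `C` by a filtered change of basis: each basis element is
replaced by itself plus a sum of basis elements of the same Maslov grading and of
bifiltration level not higher in either coordinate. -/
def FilteredBasisChange (C C' : BFC) : Prop :=
  ∃ e : C'.ι ≃ C.ι,
    (∀ u, C'.gr u = C.gr (e u)) ∧ (∀ u, C'.fa u = C.fa (e u)) ∧
    (∀ u, C'.fb u = C.fb (e u)) ∧
    ∃ P Q : Matrix C.ι C.ι (ZMod 2),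
      P * Q = 1 ∧ Q * P = 1 ∧ (∀ u, P u u = 1) ∧
      (∀ u v, u ≠ v → P u v ≠ 0 → C.gr u = C.gr v ∧ C.fa v ≤ C.fa u ∧ C.fb v ≤ C.fb u) ∧
      (∀ u v, C'.d u v = (P * Matrix.of C.d * Q) (e u) (e v))

/-- `C` satisfies `P` after some filtered change of basis. -/
def AfterFCB (C : BFC) (P : BFC → Prop) : Prop := ∃ C', FilteredBasisChange C C' ∧ P C'

/-- The knot Floer chain complex `CFK(H, s)` of the standard diagram, in the spin^c
class of the intersection point `c`: it is generated by the intersection points of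
the class of `c`; the coefficient `⟨∂x, y⟩` counts (mod 2) the embedded bigons in
the universal cover cobounded by `α̃` and `β̃ₛ` from a lift of `x` to a lift of `y`;
the relative Maslov grading drops by `1` along each differential, and the relative
`(i, j)`-bifiltration drops according to the number of lifts of the basepoints `w`
and `z` covered by each bigon. -/
def CFK (D : StdDiagram) (c : ℕ) : BFC where
  ι := {a : Fin D.p // D.SameClass a c}
  fin := Subtype.fintype _
  dec := Classical.decEq _
  d x y := (D.arrowCnt x.1 y.1 : ZMod 2)
  gr x := D.grOf c x.1
  fa x := D.faOf c x.1
  fb x := D.fbOf c x.1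


namespace CState

/-- Reversal of the direction in which a state is traversed. -/
def rev (σ : CState) : CState := ⟨σ.pos, !σ.up, σ.top, σ.ht⟩

/-- Translation of a state by `x` to the right and `h` upwards. -/
def shift (x h : ℤ) (σ : CState) : CState := ⟨σ.pos + x, σ.up, σ.top, σ.ht + h⟩

@[ext] theorem ext_fields {σ τ : CState} (h1 : σ.pos = τ.pos) (h2 : σ.up = τ.up)
    (h3 : σ.top = τ.top) (h4 : σ.ht = τ.ht) : σ = τ := by
  cases σ; cases τ; simp_all

@[simp] theorem rev_rev (σ : CState) : σ.rev.rev = σ := by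
  cases σ; simp [rev]

@[simp] theorem shift_shift (x h x' h' : ℤ) (σ : CState) :
    shift x h (shift x' h' σ) = shift (x' + x) (h' + h) σ := by
  simp [shift, add_assoc]

@[simp] theorem shift_zero (σ : CState) : shift 0 0 σ = σ := by
  cases σ; simp [shift]

theorem rev_shift (x h : ℤ) (σ : CState) : rev (shift x h σ) = shift x h (rev σ) := rfl

/-- The index of the horizontal strip next to which a state is recorded. -/
def strip (σ : CState) : ℤ := if σ.top then σ.ht - 1 else σ.ht

/-- Two states occupy the same recorded position. -/
def SamePlace (σ τ : CState) : Prop := σ.top = τ.top ∧ σ.ht = τ.ht ∧ σ.pos = τ.pos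

/-- `σ` lies to the left of `τ` on the same side of the same lift of `α`. -/
def LeftOf (σ τ : CState) : Prop := σ.top = τ.top ∧ σ.ht = τ.ht ∧ σ.pos < τ.pos

/-- The indicator of `LeftOf`, modulo two. -/
def leftInd (σ τ : CState) : ZMod 2 := if σ.LeftOf τ then 1 else 0

end CState

namespace StdDiagram

open CState

variable (D : StdDiagram)

theorem pz_pos : 0 < D.pz := by have := D.hp; unfold pz; omega

theorem emod_add_of_lt {p x t : ℤ} (h0 : 0 ≤ x % p + t) (h1 : x % p + t < p) :
    (x + t) % p = x % p + t := by
  have : x + t = (x % p + t) + p * (x / p) := by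
    have := Int.emod_add_mul_ediv x p
    linarith
  rw [this, Int.add_mul_emod_self_left, Int.emod_eq_of_lt h0 h1]

theorem step_shift (x h : ℤ) (σ : CState) :
    D.step (shift (D.pz * x) h σ) = shift (D.pz * x) h (D.step σ) := by
  obtain ⟨pos, up, top, ht⟩ := σ
  simp only [step, shift, Int.add_mul_emod_self_left]
  cases up <;> cases top <;> simp <;> (try split_ifs) <;> (try simp) <;> ring_nf <;> (try simp)

theorem stepB_eq (σ : CState) : D.stepB σ = (D.step σ.rev).rev := by
  obtain ⟨pos, up, top, ht⟩ := σ
  have h0 := Int.emod_nonneg pos D.pz_pos.ne'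
  have hq : 0 ≤ D.qz := by unfold qz; omega
  cases up <;> cases top <;> simp only [stepB, step, rev] <;> simp <;> (try split_ifs) <;>
    (try simp) <;> omega

theorem stepB_step (σ : CState) : D.stepB (D.step σ) = σ := by
  obtain ⟨pos, up, top, ht⟩ := σ
  have h0 := Int.emod_nonneg pos D.pz_pos.ne'
  have h1 := Int.emod_lt_of_pos pos D.pz_pos
  have hq : 0 ≤ D.qz := by unfold qz; omega
  have hr : 0 ≤ D.rz := by unfold rz; omega
  have h2 : 2 * D.qz + D.rz ≤ D.pz := by have := D.h2qr; unfold pz qz rz; omega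
  cases up <;> cases top
  · simp [step, stepB]
  · simp only [step, if_true, Bool.false_eq_true, if_false]
    split_ifs with a b
    · have e := emod_add_of_lt (p := D.pz) (x := pos) (t := 2 * D.qz) (by omega) (by omega)
      simp [stepB, e]
      split_ifs <;> simp <;> omega
    · have e := emod_add_of_lt (p := D.pz) (x := pos)
        (t := 2 * D.rz + 2 * D.qz - 1 - 2 * (pos % D.pz)) (by omega) (by omega)
      rw [add_comm pos] at e
      simp [stepB, e]
      split_ifs <;> simp <;> omega
    · simp [stepB]
      split_ifs <;> simp <;> omega
  · simp only [step, if_true, Bool.true_eq_false, Bool.false_eq_true, if_false]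
    split_ifs with a b
    · have e := emod_add_of_lt (p := D.pz) (x := pos)
        (t := 2 * D.qz - 1 - 2 * (pos % D.pz)) (by omega) (by omega)
      rw [add_comm pos] at e
      simp [stepB, e]
      split_ifs <;> simp <;> omega
    · have e := emod_add_of_lt (p := D.pz) (x := pos) (t := - (2 * D.qz)) (by omega) (by omega)
      rw [← sub_eq_add_neg] at e
      simp [stepB, e]
      split_ifs <;> simp <;> omega
    · simp [stepB]
      split_ifs <;> simp <;> omega
  · simp [step, stepB]

theorem step_stepB (σ : CState) : D.step (D.stepB σ) = σ := by
  have h := D.stepB_step (D.stepB σ.rev).rev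
  rw [D.stepB_eq σ.rev] at h
  simp only [rev_rev] at h
  rw [D.stepB_eq]
  have h2 := D.stepB_step σ.rev
  rw [D.stepB_eq] at h2
  simpa using congrArg rev h2

/-- `step` as a permutation of the states. -/
def stepPerm : Equiv.Perm CState := ⟨D.step, D.stepB, D.stepB_step, D.step_stepB⟩

/-- States from which `step` traverses a strip rather than crossing a lift of `α`. -/
def StripStart (σ : CState) : Prop := σ.top ≠ σ.up

theorem stripStart_step (σ : CState) : StripStart (D.step σ) ↔ ¬ StripStart σ := by
  obtain ⟨pos, up, top, ht⟩ := σ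
  cases up <;> cases top <;> simp only [StripStart, step] <;> simp <;> split_ifs <;> simp

/-- Matching of bottom-edge and top-edge positions by the strands crossing a strip. -/
def StrandRel (b t : ℤ) : Prop :=
  ∃ k m, b = D.pz * k + m ∧ ((2 * D.qz ≤ m ∧ m < 2 * D.qz + D.rz ∧ t = D.pz * k + m - 2 * D.qz) ∨
    (2 * D.qz + D.rz ≤ m ∧ m < D.pz ∧ t = D.pz * k + m))

/-- The arcs of a strip, with their possible directions of traversal. -/
theorem step_strip {σ : CState} (h : StripStart σ) :
    (σ.top = false ∧ (D.step σ).top = false ∧ (D.step σ).ht = σ.ht ∧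
      ∃ k m, 0 ≤ m ∧ m < 2 * D.qz ∧ σ.pos = D.pz * k + m ∧
        (D.step σ).pos = D.pz * k + (2 * D.qz - 1 - m)) ∨
    (σ.top = true ∧ (D.step σ).top = true ∧ (D.step σ).ht = σ.ht ∧
      ∃ k m, D.rz ≤ m ∧ m < D.rz + 2 * D.qz ∧ σ.pos = D.pz * k + m ∧
        (D.step σ).pos = D.pz * k + (2 * D.rz + 2 * D.qz - 1 - m)) ∨
    (σ.top = false ∧ (D.step σ).top = true ∧ (D.step σ).ht = σ.ht + 1 ∧
      D.StrandRel σ.pos (D.step σ).pos) ∨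
    (σ.top = true ∧ (D.step σ).top = false ∧ (D.step σ).ht = σ.ht - 1 ∧
      D.StrandRel (D.step σ).pos σ.pos) := by
  obtain ⟨pos, up, top, ht⟩ := σ
  have h0 := Int.emod_nonneg pos D.pz_pos.ne'
  have h1 := Int.emod_lt_of_pos pos D.pz_pos
  have h3 := Int.emod_add_mul_ediv pos D.pz
  cases up <;> cases top
  · simp [StripStart] at h
  · simp only [step, if_true, Bool.false_eq_true, if_false]
    split_ifs with a b
    · right; right; right
      refine ⟨by simp, by simp, by simp, pos / D.pz, pos % D.pz + 2 * D.qz, by dsimp only; omega,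
        Or.inl ⟨by omega, by omega, by omega⟩⟩
    · right; left
      refine ⟨by simp, by simp, by simp, pos / D.pz, pos % D.pz, by omega, by omega, by omega,
        by dsimp only; omega⟩
    · right; right; right
      refine ⟨by simp, by simp, by simp, pos / D.pz, pos % D.pz, by dsimp only; omega,
        Or.inr ⟨by omega, by omega, by omega⟩⟩
  · simp only [step, if_true, Bool.true_eq_false, Bool.false_eq_true, if_false]
    split_ifs with a b
    · left
      refine ⟨by simp, by simp, by simp, pos / D.pz, pos % D.pz, by omega, by omega, by omega,
        by dsimp only; omega⟩
    · right; right; left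
      refine ⟨by simp, by simp, by simp, pos / D.pz, pos % D.pz, by omega,
        Or.inl ⟨by omega, by omega, by dsimp only; omega⟩⟩
    · right; right; left
      refine ⟨by simp, by simp, by simp, pos / D.pz, pos % D.pz, by omega,
        Or.inr ⟨by omega, by omega, by dsimp only; omega⟩⟩
  · simp [StripStart] at h

/-- The effect of `step` on states at which a lift of `α` is crossed. -/
theorem step_cross {σ : CState} (h : ¬ StripStart σ) :
    (D.step σ).ht = σ.ht ∧
      ((σ.top = true ∧ (D.step σ).top = false ∧ (D.step σ).pos = σ.pos + D.sz) ∨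
        (σ.top = false ∧ (D.step σ).top = true ∧ (D.step σ).pos = σ.pos - D.sz)) := by
  obtain ⟨pos, up, top, ht⟩ := σ
  cases up <;> cases top <;> simp [StripStart] at h <;> simp [step]

theorem ite_sum_four {A B C E : Prop} (h : (A ↔ B) ↔ (C ↔ E)) :
    (if A then (1 : ZMod 2) else 0) + (if B then 1 else 0) + (if C then 1 else 0)
      + (if E then 1 else 0) = 0 := by
  by_cases A <;> by_cases B <;> by_cases C <;> by_cases E <;> simp_all <;> decide

theorem iff_of_ite_sum_four {A B C E : Prop}
    (h : (if A then (1 : ZMod 2) else 0) + (if B then 1 else 0) + (if C then 1 else 0)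
      + (if E then 1 else 0) = 0) : (A ↔ B) ↔ (C ↔ E) := by
  by_cases A <;> by_cases B <;> by_cases C <;> by_cases E <;> simp_all <;>
    exact absurd h (by decide)

theorem mul_lt_trichotomy {p : ℤ} (hp : 0 < p) (k l : ℤ) :
    p * k = p * l ∨ p * k + p ≤ p * l ∨ p * l + p ≤ p * k := by
  rcases lt_trichotomy k l with h | h | h
  · right; left; nlinarith
  · left; rw [h]
  · right; right; nlinarith

/-- Disjoint arcs of a strip do not cross. -/
theorem leftInd_sum_strip {σ τ : CState} (hσ : StripStart σ) (hτ : StripStart τ)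
    (h1 : ¬ SamePlace σ τ) (h2 : ¬ SamePlace σ (D.step τ)) (h3 : ¬ SamePlace (D.step σ) τ)
    (h4 : ¬ SamePlace (D.step σ) (D.step τ)) :
    leftInd σ τ + leftInd σ (D.step τ) + leftInd (D.step σ) τ
      + leftInd (D.step σ) (D.step τ) = 0 := by
  have hσ' := D.step_strip hσ
  have hτ' := D.step_strip hτ
  have hp := D.pz_pos
  have hq : 0 ≤ D.qz := by unfold qz; omega
  have hr : 0 ≤ D.rz := by unfold rz; omega
  have hpqr : 2 * D.qz + D.rz ≤ D.pz := by have := D.h2qr; unfold pz qz rz; omega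
  apply ite_sum_four
  unfold SamePlace at h1 h2 h3 h4
  unfold LeftOf
  generalize D.step σ = σ' at *
  generalize D.step τ = τ' at *
  obtain ⟨x, u, a, h⟩ := σ
  obtain ⟨x', u', a', h'⟩ := σ'
  obtain ⟨y, v, b, g⟩ := τ
  obtain ⟨y', v', b', g'⟩ := τ'
  simp only at *
  unfold StrandRel at *
  rcases hσ' with ⟨rfl, rfl, rfl, k, m, c⟩ | ⟨rfl, rfl, rfl, k, m, c⟩ |
    ⟨rfl, rfl, rfl, k, m, rfl, c⟩ | ⟨rfl, rfl, rfl, k, m, rfl, c⟩ <;>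
  rcases hτ' with ⟨rfl, rfl, rfl, l, n, d⟩ | ⟨rfl, rfl, rfl, l, n, d⟩ |
    ⟨rfl, rfl, rfl, l, n, rfl, d⟩ | ⟨rfl, rfl, rfl, l, n, rfl, d⟩ <;>
  have tri := mul_lt_trichotomy hp k l <;>
  simp only [eq_self, true_and, reduceCtorEq, false_and, not_false_eq_true, iff_false, false_iff,
    iff_true, true_iff] at * <;>
  generalize D.pz * k = K at * <;>
  generalize D.pz * l = L at * <;>
  omega

/-- Crossing a lift of `α` preserves the order of the points on it. -/
theorem leftInd_sum_cross {σ τ : CState} (hσ : ¬ StripStart σ) (hτ : ¬ StripStart τ) :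
    leftInd σ τ + leftInd σ (D.step τ) + leftInd (D.step σ) τ
      + leftInd (D.step σ) (D.step τ) = 0 := by
  have hσ' := D.step_cross hσ
  have hτ' := D.step_cross hτ
  apply ite_sum_four
  unfold LeftOf
  rcases hσ' with ⟨e1, ⟨e2, e3, e4⟩ | ⟨e2, e3, e4⟩⟩ <;>
  rcases hτ' with ⟨e1', ⟨e2', e3', e4'⟩ | ⟨e2', e3', e4'⟩⟩ <;>
  rw [e1, e2, e3, e4, e1', e2', e3', e4'] <;> (simp; try omega)

/-- The order and grading data of the successive intersection points `x 0, …, x (n - 1)` of a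
lift of `β` with a lift of `α`: `γ` is the grading and the compact arcs starting at points of
equal parity, as well as the two rays, are disjoint. -/
structure Meander (n : ℕ) (x γ : ℕ → ℤ) : Prop where
  odd : n % 2 = 1
  inj : ∀ i j, i < n → j < n → x i = x j → i = j
  step : ∀ i, i + 1 < n → γ (i + 1) = γ i + if (i % 2 = 0 ↔ x i < x (i + 1)) then 1 else -1
  arcs : ∀ i j, i + 1 < n → j + 1 < n → i ≠ j → i % 2 = j % 2 →
    ((x i < x j ↔ x i < x (j + 1)) ↔ (x (i + 1) < x j ↔ x (i + 1) < x (j + 1)))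
  upperRay : ∀ i, i + 1 < n → i % 2 = 0 → (x i < x (n - 1) ↔ x (i + 1) < x (n - 1))
  lowerRay : ∀ i, i + 1 < n → i % 2 = 1 → (x i < x 0 ↔ x (i + 1) < x 0)

namespace Meander

variable {n : ℕ} {x γ : ℕ → ℤ}

theorem reverse (h : Meander n x γ) :
    Meander n (fun i => - x (n - 1 - i)) (fun i => γ (n - 1 - i)) := by
  have hodd := h.odd
  refine ⟨h.odd, ?_, ?_, ?_, ?_, ?_⟩
  · intro i j hi hj e
    have := h.inj (n - 1 - i) (n - 1 - j) (by omega) (by omega) (by simpa using e)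
    omega
  · intro i hi
    obtain ⟨j, hj⟩ : ∃ j, j = n - 1 - (i + 1) := ⟨_, rfl⟩
    have e : n - 1 - i = j + 1 := by omega
    have hs := h.step j (by omega)
    have hd := h.inj j (j + 1) (by omega) (by omega)
    simp only [← hj, e]
    split_ifs at hs ⊢ <;> omega
  · intro i j hi hj hij hp
    obtain ⟨i', hi'⟩ : ∃ j, j = n - 1 - (i + 1) := ⟨_, rfl⟩
    obtain ⟨j', hj'⟩ : ∃ k, k = n - 1 - (j + 1) := ⟨_, rfl⟩
    have e : n - 1 - i = i' + 1 := by omega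
    have e' : n - 1 - j = j' + 1 := by omega
    have ha := h.arcs i' j' (by omega) (by omega) (by omega) (by omega)
    have d1 := h.inj i' j' (by omega) (by omega)
    have d2 := h.inj (i' + 1) j' (by omega) (by omega)
    have d3 := h.inj i' (j' + 1) (by omega) (by omega)
    have d4 := h.inj (i' + 1) (j' + 1) (by omega) (by omega)
    have a1 := h.arcs j' i' (by omega) (by omega) (by omega) (by omega)
    simp only [← hi', ← hj', e, e']
    omega
  · intro i hi hp
    obtain ⟨i', hi'⟩ : ∃ j, j = n - 1 - (i + 1) := ⟨_, rfl⟩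
    have e : n - 1 - i = i' + 1 := by omega
    have ha := h.lowerRay i' (by omega) (by omega)
    have d1 := h.inj i' 0 (by omega) (by omega)
    have d2 := h.inj (i' + 1) 0 (by omega) (by omega)
    simp only [← hi', e, Nat.sub_self]
    omega
  · intro i hi hp
    obtain ⟨i', hi'⟩ : ∃ j, j = n - 1 - (i + 1) := ⟨_, rfl⟩
    have e : n - 1 - i = i' + 1 := by omega
    have ha := h.upperRay i' (by omega) (by omega)
    have d1 := h.inj i' (n - 1) (by omega) (by omega)
    have d2 := h.inj (i' + 1) (n - 1) (by omega) (by omega)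
    simp only [← hi', e, Nat.sub_zero]
    omega

theorem grading_mod_two (h : Meander n x γ) (i : ℕ) (hi : i < n) : (γ i - γ 0 - i) % 2 = 0 := by
  induction i with
  | zero => simp
  | succ i ih =>
    have := ih (by omega)
    have hs := h.step i hi
    push_cast
    split_ifs at hs <;> omega

/-- With gradings in an interval of length two, a unique lowest point is not the first one. -/
theorem lowest_ne_zero_of_three (h : Meander n x γ) (hn : 1 < n) {g : ℤ}
    (hlo : ∀ i, i < n → g ≤ γ i) (hhi : ∀ i, i < n → γ i ≤ g + 2)
    (huniq : ∀ i, i < n → γ i = g → i = 0) : γ 0 ≠ g := by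
  intro h0
  have hodd := h.odd
  have hdec : ∀ i, 1 ≤ i → i + 1 < n → x (i + 1) < x i := by
    intro i hi hin
    have p1 := h.grading_mod_two i (by omega)
    have p2 := h.grading_mod_two (i + 1) hin
    have b1 := hlo i (by omega)
    have b2 := hlo (i + 1) hin
    have c1 := hhi i (by omega)
    have c2 := hhi (i + 1) hin
    have u1 := huniq i (by omega)
    have u2 := huniq (i + 1) hin
    have hs := h.step i hin
    have hd := h.inj i (i + 1) (by omega) hin
    push_cast at p2
    split_ifs at hs <;> omega
  have h01 : x 0 < x 1 := by
    have hs := h.step 0 (by omega)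
    have b1 := hlo 1 (by omega)
    have hd := h.inj 0 1 (by omega) (by omega)
    simp only [Nat.zero_add, true_iff] at hs
    split_ifs at hs <;> omega
  have key : ∀ i, 1 ≤ i → i < n → x 0 < x i ∧ x i ≤ x 1 := by
    intro i hi
    induction i, hi using Nat.le_induction with
    | base => intro _; omega
    | succ i hi ih =>
      intro hin
      have hi' := ih (by omega)
      have hd := hdec i hi hin
      have d0 := h.inj (i + 1) 0 hin (by omega)
      rcases Nat.mod_two_eq_zero_or_one i with hp | hp
      · have := h.arcs 0 i (by omega) hin (by omega) (by omega)
        simp only [Nat.zero_add] at this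
        omega
      · have := h.lowerRay i hin hp
        omega
  have k1 := key (n - 2) (by omega) (by omega)
  have k2 := key (n - 1) (by omega) (by omega)
  have k3 := hdec (n - 2) (by omega) (by omega)
  have e : n - 2 + 1 = n - 1 := by omega
  rw [e] at k3
  have := h.upperRay 0 (by omega) rfl
  simp only [Nat.zero_add] at this
  omega

/-- With gradings in an interval of length three and at most two points in the grading next to
the lowest one, a unique lowest point is not the first one. -/
theorem lowest_ne_zero_of_four (h : Meander n x γ) (hn : 1 < n) {g : ℤ}
    (hlo : ∀ i, i < n → g ≤ γ i) (hhi : ∀ i, i < n → γ i ≤ g + 3)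
    (huniq : ∀ i, i < n → γ i = g → i = 0)
    (htwo : ∀ i j k, i < n → j < n → k < n → i < j → j < k →
      γ i = g + 1 → γ j = g + 1 → γ k ≠ g + 1) : γ 0 ≠ g := by
  intro h0
  have hodd := h.odd
  have h01 : x 0 < x 1 ∧ γ 1 = g + 1 := by
    have hs := h.step 0 (by omega)
    have b1 := hlo 1 (by omega)
    have hd := h.inj 0 1 (by omega) (by omega)
    simp only [Nat.zero_add, true_iff] at hs
    split_ifs at hs <;> omega
  obtain ⟨h01, g1⟩ := h01
  have geven : ∀ i, 1 ≤ i → i < n → i % 2 = 0 → γ i = g + 2 := by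
    intro i hi hin hp
    have p1 := h.grading_mod_two i (by omega)
    have b1 := hlo i (by omega)
    have c1 := hhi i (by omega)
    have u1 := huniq i (by omega)
    omega
  have hupward : ∀ i, 2 ≤ i → i + 1 < n → γ i ≠ g + 1 → γ (i + 1) ≠ g + 1 → x i < x (i + 1) := by
    intro i hi hin l1 l2
    have hs := h.step i hin
    have hd := h.inj i (i + 1) (by omega) hin
    have b1 := hlo i (by omega)
    have b2 := hlo (i + 1) (by omega)
    have u1 := huniq i (by omega)
    have u2 := huniq (i + 1) (by omega)
    rcases Nat.mod_two_eq_zero_or_one i with hp | hp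
    · have := geven i (by omega) (by omega) hp
      split_ifs at hs <;> omega
    · have := geven (i + 1) (by omega) (by omega) (by omega)
      split_ifs at hs <;> omega
  have h12 : x 2 < x 1 := by
    have hs := h.step 1 (by omega)
    have := geven 2 (by omega) (by omega) rfl
    have hd := h.inj 1 2 (by omega) (by omega)
    norm_num at hs
    split_ifs at hs <;> omega
  have h02 : x 0 < x 2 := by
    have := h.lowerRay 1 (by omega) rfl
    have hd := h.inj 0 2 (by omega) (by omega)
    simp only [Nat.reduceAdd] at this
    omega
  have arc0 : ∀ i, 2 ≤ i → i + 1 < n → i % 2 = 0 → x 0 < x i → x i < x 1 →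
      x 0 < x (i + 1) ∧ x (i + 1) < x 1 := by
    intro i hi hin hp a b
    have := h.arcs 0 i (by omega) hin (by omega) (by omega)
    have d1 := h.inj 0 (i + 1) (by omega) (by omega)
    have d2 := h.inj 1 (i + 1) (by omega) (by omega)
    simp only [Nat.zero_add] at this
    omega
  have arc1 : ∀ i, 2 ≤ i → i + 1 < n → i % 2 = 1 → x 2 < x i → x i < x 1 →
      x 2 < x (i + 1) ∧ x (i + 1) < x 1 := by
    intro i hi hin hp a b
    have := h.arcs 1 i (by omega) hin (by omega) (by omega)
    have d1 := h.inj 1 (i + 1) (by omega) (by omega)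
    have d2 := h.inj 2 (i + 1) (by omega) (by omega)
    simp only [Nat.reduceAdd] at this
    omega
  have stay : ∀ k, 2 ≤ k → x 2 ≤ x k → x k < x 1 → (∀ i, k ≤ i → i < n → γ i = g + 1 → i = k) →
      (k % 2 = 1 → γ k ≠ g + 1) →
      ∀ i, k ≤ i → i < n → x 2 ≤ x i ∧ x i < x 1 := by
    intro k hk a b hlow hk' i hi
    induction i, hi using Nat.le_induction with
    | base => intro _; exact ⟨a, b⟩
    | succ i hi ih =>
      intro hin
      have hi' := ih (by omega)
      have d2 := h.inj 2 i (by omega) (by omega)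
      have l1 := hlow i (by omega) (by omega)
      have l2 := hlow (i + 1) (by omega) (by omega)
      have hne : γ i ≠ g + 1 := by
        intro e
        have := l1 e
        rcases Nat.mod_two_eq_zero_or_one i with hp | hp
        · have := geven i (by omega) (by omega) hp
          omega
        · exact hk' (this ▸ hp) (this ▸ e)
      have hup := hupward i (by omega) hin hne (by omega)
      rcases Nat.mod_two_eq_zero_or_one i with hp | hp
      · have := arc0 i (by omega) hin hp (by omega) (by omega)
        omega
      · have := arc1 i (by omega) hin hp (by omega) (by omega)
        omega
  suffices hfin : x 0 < x (n - 1) ∧ x (n - 1) < x 1 by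
    have := h.upperRay 0 (by omega) rfl
    simp only [Nat.zero_add] at this
    omega
  by_cases hj : ∃ j, 2 ≤ j ∧ j < n ∧ γ j = g + 1
  · obtain ⟨j, hj2, hjn, gj⟩ := hj
    have hjodd : j % 2 = 1 := by
      by_contra hp
      have := geven j (by omega) hjn (by omega)
      omega
    have honly : ∀ i, 2 ≤ i → i < n → γ i = g + 1 → i = j := by
      intro i hi hin e
      by_contra hne
      rcases lt_or_gt_of_ne hne with hlt | hlt
      · exact htwo 1 i j (by omega) hin hjn (by omega) hlt g1 e gj
      · exact htwo 1 j i (by omega) hjn hin (by omega) hlt g1 gj e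
    have before : ∀ i, 2 ≤ i → i < j → x 2 ≤ x i ∧ x i < x 1 := by
      intro i hi
      induction i, hi using Nat.le_induction with
      | base => intro _; omega
      | succ i hi ih =>
        intro hin
        have hi' := ih (by omega)
        have d2 := h.inj 2 i (by omega) (by omega)
        have l1 := honly i (by omega) (by omega)
        have l2 := honly (i + 1) (by omega) (by omega)
        have hup := hupward i (by omega) (by omega) (by omega) (by omega)
        rcases Nat.mod_two_eq_zero_or_one i with hp | hp
        · have := arc0 i (by omega) (by omega) hp (by omega) (by omega)
          omega
        · have := arc1 i (by omega) (by omega) hp (by omega) (by omega)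
          omega
    obtain ⟨j, rfl⟩ : ∃ k, j = k + 1 := ⟨j - 1, by omega⟩
    have hb := before j (by omega) (by omega)
    have hj1 : x (j + 1) < x j := by
      have hs := h.step j (by omega)
      have := geven j (by omega) (by omega) (by omega)
      have hd := h.inj j (j + 1) (by omega) (by omega)
      split_ifs at hs <;> omega
    have hj2' : x (j + 1 + 1) < x (j + 1) := by
      have hs := h.step (j + 1) (by omega)
      have := geven (j + 1 + 1) (by omega) (by omega) (by omega)
      have hd := h.inj (j + 1) (j + 1 + 1) (by omega) (by omega)
      split_ifs at hs <;> omega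
    have hj0 := arc0 j (by omega) (by omega) (by omega) (by omega) (by omega)
    have hj0' : x 0 < x (j + 1 + 1) := by
      have := h.lowerRay (j + 1) (by omega) hjodd
      have hd := h.inj 0 (j + 1 + 1) (by omega) (by omega)
      omega
    have hdj := h.inj 2 (j + 1) (by omega) (by omega)
    rcases lt_or_ge (x 2) (x (j + 1)) with hc | hc
    · have h3 := arc1 (j + 1) (by omega) (by omega) hjodd hc hj0.2
      have := stay (j + 1 + 1) (by omega) (by omega) h3.2
        (fun i hi hin e => by have := honly i (by omega) hin e; omega)
        (fun hp => by omega) (n - 1) (by omega) (by omega)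
      omega
    · have key : ∀ i, j + 1 + 1 ≤ i → i < n →
          (x (j + 1 + 1) ≤ x i ∧ x i < x (j + 1)) ∨ (x 2 < x i ∧ x i < x 1) := by
        intro i hi
        induction i, hi using Nat.le_induction with
        | base => intro _; omega
        | succ i hi ih =>
          intro hin
          have hi' := ih (by omega)
          have l1 := honly i (by omega) (by omega)
          have l2 := honly (i + 1) (by omega) (by omega)
          have hup := hupward i (by omega) (by omega) (by omega) (by omega)
          rcases Nat.mod_two_eq_zero_or_one i with hp | hp
          · have a0 := arc0 i (by omega) (by omega) hp (by omega) (by omega)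
            have a1 := h.arcs j i (by omega) hin (by omega) (by omega)
            have d1 := h.inj j (i + 1) (by omega) (by omega)
            have d2 := h.inj (j + 1) (i + 1) (by omega) (by omega)
            omega
          · have a1 := h.arcs (j + 1) i (by omega) hin (by omega) (by omega)
            have d1 := h.inj (j + 1) (i + 1) (by omega) (by omega)
            have d2 := h.inj (j + 1 + 1) (i + 1) (by omega) (by omega)
            have d3 := h.inj (j + 1 + 1) i (by omega) (by omega)
            rcases hi' with hi' | hi'
            · omega
            · have := arc1 i (by omega) hin hp hi'.1 hi'.2
              omega
      have := key (n - 1) (by omega) (by omega)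
      omega
  · push Not at hj
    have := stay 2 le_rfl le_rfl h12
      (fun i hi hin e => absurd e (hj i hi hin)) (by simp) (n - 1) (by omega) (by omega)
    omega

theorem interior_of_lowest_of_three (h : Meander n x γ) (hn : 1 < n) {g : ℤ}
    (hlo : ∀ i, i < n → g ≤ γ i) (hhi : ∀ i, i < n → γ i ≤ g + 2) {m : ℕ} (hm : m < n)
    (hg : γ m = g) (huniq : ∀ i, i < n → γ i = g → i = m) : 0 < m ∧ m + 1 < n := by
  constructor
  · refine Nat.pos_of_ne_zero fun h0 => ?_
    subst h0
    exact h.lowest_ne_zero_of_three hn hlo hhi huniq hg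
  · by_contra hlast
    obtain rfl : m = n - 1 := by omega
    refine h.reverse.lowest_ne_zero_of_three hn (fun i hi => hlo _ (by omega))
      (fun i hi => hhi _ (by omega)) (fun i hi e => ?_) hg
    have := huniq _ (by omega) e
    omega

theorem interior_of_lowest_of_four (h : Meander n x γ) (hn : 1 < n) {g : ℤ}
    (hlo : ∀ i, i < n → g ≤ γ i) (hhi : ∀ i, i < n → γ i ≤ g + 3)
    (htwo : ∀ i j k, i < n → j < n → k < n → i < j → j < k →
      γ i = g + 1 → γ j = g + 1 → γ k ≠ g + 1) {m : ℕ} (hm : m < n)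
    (hg : γ m = g) (huniq : ∀ i, i < n → γ i = g → i = m) : 0 < m ∧ m + 1 < n := by
  constructor
  · refine Nat.pos_of_ne_zero fun h0 => ?_
    subst h0
    exact h.lowest_ne_zero_of_four hn hlo hhi huniq htwo hg
  · by_contra hlast
    obtain rfl : m = n - 1 := by omega
    refine h.reverse.lowest_ne_zero_of_four hn (fun i hi => hlo _ (by omega))
      (fun i hi => hhi _ (by omega)) (fun i hi e => ?_)
      (fun i j k hi hj hk hij hjk ei ej ek => ?_) hg
    · have := huniq _ (by omega) e
      omega
    · exact htwo (n - 1 - k) (n - 1 - j) (n - 1 - i) (by omega) (by omega) (by omega)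
        (by omega) (by omega) ek ej ei

end Meander

/-- A sum over a grid which vanishes on the squares of two interleaved subdivisions and on the
relative interior of the boundary vanishes on the corners. -/
theorem corner_sum_eq_zero (f : ℕ → ℕ → ZMod 2) (n m : ℕ)
    (h1 : ∀ i ≤ n, ∀ j ≤ m, f (2 * i) (2 * j) + f (2 * i) (2 * j + 1) + f (2 * i + 1) (2 * j)
      + f (2 * i + 1) (2 * j + 1) = 0)
    (h2 : ∀ i < n, ∀ j < m, f (2 * i + 1) (2 * j + 1) + f (2 * i + 1) (2 * j + 1 + 1)
      + f (2 * i + 1 + 1) (2 * j + 1) + f (2 * i + 1 + 1) (2 * j + 1 + 1) = 0)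
    (h3 : ∀ i < 2 * n, f (i + 1) 0 = 0 ∧ f (i + 1) (2 * m + 1) = 0)
    (h4 : ∀ j < 2 * m, f 0 (j + 1) = 0 ∧ f (2 * n + 1) (j + 1) = 0) :
    f 0 0 + f 0 (2 * m + 1) + f (2 * n + 1) 0 + f (2 * n + 1) (2 * m + 1) = 0 := by
  have hpair : ∀ (g : ℕ → ZMod 2) (k : ℕ), ∑ i ∈ Finset.range (2 * k), g i
      = ∑ i ∈ Finset.range k, (g (2 * i) + g (2 * i + 1)) := by
    intro g k
    induction k with
    | zero => simp
    | succ k ih =>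
      rw [show 2 * (k + 1) = 2 * k + 1 + 1 by ring, Finset.sum_range_succ, Finset.sum_range_succ,
        Finset.sum_range_succ, ih, add_assoc]
  have hends : ∀ (g : ℕ → ZMod 2) (k : ℕ), ∑ i ∈ Finset.range (2 * (k + 1)), g i
      = g 0 + ∑ i ∈ Finset.range (2 * k), g (i + 1) + g (2 * k + 1) := by
    intro g k
    rw [show 2 * (k + 1) = 2 * k + 1 + 1 by ring, Finset.sum_range_succ, Finset.sum_range_succ',
      add_comm (g 0)]
  have t1 : ∑ i ∈ Finset.range (2 * (n + 1)), ∑ j ∈ Finset.range (2 * (m + 1)), f i j = 0 := by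
    rw [hpair]
    apply Finset.sum_eq_zero
    intro i hi
    rw [hpair, hpair, ← Finset.sum_add_distrib]
    apply Finset.sum_eq_zero
    intro j hj
    rw [Finset.mem_range] at hi hj
    rw [← h1 i (by omega) j (by omega)]
    ring
  have t2 : ∑ i ∈ Finset.range (2 * n), ∑ j ∈ Finset.range (2 * m), f (i + 1) (j + 1) = 0 := by
    rw [hpair]
    apply Finset.sum_eq_zero
    intro i hi
    rw [hpair, hpair, ← Finset.sum_add_distrib]
    apply Finset.sum_eq_zero
    intro j hj
    rw [Finset.mem_range] at hi hj
    rw [← h2 i (by omega) j (by omega)]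
    ring
  have t3 : ∑ i ∈ Finset.range (2 * n), ∑ j ∈ Finset.range (2 * (m + 1)), f (i + 1) j = 0 := by
    rw [← t2]
    apply Finset.sum_congr rfl
    intro i hi
    rw [Finset.mem_range] at hi
    rw [hends, (h3 i hi).1, (h3 i hi).2]
    simp
  rw [hends, t3, hends, hends, Finset.sum_eq_zero (s := Finset.range (2 * m)),
    Finset.sum_eq_zero (s := Finset.range (2 * m))] at t1
  · rw [← t1]
    ring
  · intro j hj
    exact (h4 j (Finset.mem_range.1 hj)).2
  · intro j hj
    exact (h4 j (Finset.mem_range.1 hj)).1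

/-- A bi-infinite traversal, without self-intersections, of a lift of `β` coming from far below
and going far above. -/
structure IsLift (S : ℤ → CState) : Prop where
  step : ∀ i, S (i + 1) = D.step (S i)
  inj : ∀ i j, SamePlace (S i) (S j) → i = j
  above : ∀ K : ℤ, ∃ N : ℤ, ∀ i, N ≤ i → K < (S i).ht
  below : ∀ K : ℤ, ∃ N : ℤ, ∀ i, i ≤ N → (S i).ht < K

/-- The state is recorded on the given side of the line `y = 0`. -/
def OnSide (t : Bool) (σ : CState) : Prop := σ.top = t ∧ σ.ht = 0

theorem leftInd_eq_zero_of_onSide {t : Bool} {σ τ : CState} (hσ : OnSide t σ)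
    (hτ : ¬ OnSide t τ) : leftInd σ τ = 0 ∧ leftInd τ σ = 0 := by
  unfold OnSide at *
  unfold leftInd LeftOf
  constructor <;> rw [if_neg] <;> rintro ⟨h1, h2, h3⟩ <;> exact hτ (by grind)

theorem leftInd_eq_zero_of_ht {σ τ : CState} (h : σ.ht ≠ τ.ht) :
    leftInd σ τ = 0 ∧ leftInd τ σ = 0 := by
  unfold leftInd LeftOf
  constructor <;> rw [if_neg] <;> grind

theorem leftInd_of_onSide {t : Bool} {σ τ : CState} (hσ : OnSide t σ) (hτ : OnSide t τ) :
    leftInd σ τ = if σ.pos < τ.pos then 1 else 0 := by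
  unfold OnSide at *
  unfold leftInd LeftOf
  congr 1
  grind

namespace IsLift

variable {D} {S : ℤ → CState} (hS : D.IsLift S)
include hS

theorem stripStart_add_two_mul (i : ℤ) (k : ℕ) :
    StripStart (S (i + 2 * k)) ↔ StripStart (S i) := by
  induction k with
  | zero => simp
  | succ k ih =>
    rw [show i + 2 * ((k + 1 : ℕ) : ℤ) = i + 2 * k + 1 + 1 by push_cast; ring, hS.step,
      stripStart_step, hS.step, stripStart_step, not_not, ih]

theorem stripStart_add_two_mul_succ (i : ℤ) (k : ℕ) :
    StripStart (S (i + (2 * k + 1))) ↔ ¬ StripStart (S i) := by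
  rw [show i + (2 * (k : ℤ) + 1) = i + 2 * k + 1 by ring, hS.step, stripStart_step,
    hS.stripStart_add_two_mul]

/-- An odd number of moves separates a state at the start of a strip from one which is not. -/
theorem exists_odd_of_stripStart {i j : ℤ} (hij : i ≤ j) (hi : StripStart (S i))
    (hj : ¬ StripStart (S j)) : ∃ k : ℕ, j = i + (2 * k + 1) := by
  obtain ⟨k, hk⟩ : ∃ k : ℕ, k = ((j - i) / 2).toNat := ⟨_, rfl⟩
  rcases Int.emod_two_eq_zero_or_one (j - i) with h | h
  · have e : j = i + 2 * k := by omega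
    rw [e, hS.stripStart_add_two_mul] at hj
    exact absurd hi hj
  · exact ⟨k, by omega⟩

theorem leftInd_corner_sum {a b : ℤ} {n m : ℕ} (ha : StripStart (S a)) (hb : StripStart (S b))
    (hab : a + (2 * n + 1) < b ∨ b + (2 * m + 1) < a)
    (h3 : ∀ i : ℤ, a < i → i < a + (2 * n + 1) →
      leftInd (S i) (S b) = 0 ∧ leftInd (S i) (S (b + (2 * m + 1))) = 0)
    (h4 : ∀ j : ℤ, b < j → j < b + (2 * m + 1) →
      leftInd (S a) (S j) = 0 ∧ leftInd (S (a + (2 * n + 1))) (S j) = 0) :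
    leftInd (S a) (S b) + leftInd (S a) (S (b + (2 * m + 1)))
      + leftInd (S (a + (2 * n + 1))) (S b)
      + leftInd (S (a + (2 * n + 1))) (S (b + (2 * m + 1))) = 0 := by
  have key := corner_sum_eq_zero (fun i j => leftInd (S (a + i)) (S (b + j))) n m
  simp only [Nat.cast_add, Nat.cast_mul, Nat.cast_ofNat, Nat.cast_one, Nat.cast_zero,
    add_zero] at key
  apply key
  · intro i hi j hj
    have e1 : S (a + (2 * i + 1)) = D.step (S (a + 2 * i)) := by rw [← hS.step, add_assoc]
    have e2 : S (b + (2 * j + 1)) = D.step (S (b + 2 * j)) := by rw [← hS.step, add_assoc]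
    rw [e1, e2]
    apply leftInd_sum_strip
    · rwa [hS.stripStart_add_two_mul]
    · rwa [hS.stripStart_add_two_mul]
    all_goals
      try rw [← e1]
      try rw [← e2]
      intro h
      have := hS.inj _ _ h
      omega
  · intro i hi j hj
    have e1 : S (a + (2 * i + 1 + 1)) = D.step (S (a + (2 * i + 1))) := by
      rw [← hS.step]; congr 1; ring
    have e2 : S (b + (2 * j + 1 + 1)) = D.step (S (b + (2 * j + 1))) := by
      rw [← hS.step]; congr 1; ring
    rw [e1, e2]
    apply leftInd_sum_cross
    · rw [hS.stripStart_add_two_mul_succ, not_not]; exact ha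
    · rw [hS.stripStart_add_two_mul_succ, not_not]; exact hb
  · intro i hi
    exact h3 _ (by omega) (by omega)
  · intro j hj
    exact h4 _ (by omega) (by omega)

end IsLift

/-- The states `S a, …, S (a + 2 n + 1)` form a compact arc with ends on one side of the line
`y = 0` and interior disjoint from that side. -/
structure IsArc (S : ℤ → CState) (t : Bool) (a : ℤ) (n : ℕ) : Prop where
  start : StripStart (S a)
  left : OnSide t (S a)
  right : OnSide t (S (a + (2 * n + 1)))
  inner : ∀ i : ℤ, a < i → i < a + (2 * n + 1) → ¬ OnSide t (S i)

namespace IsLift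

variable {D} {S : ℤ → CState} (hS : D.IsLift S)
include hS

theorem arc_arc {t : Bool} {a b : ℤ} {n m : ℕ} (ha : IsArc S t a n) (hb : IsArc S t b m)
    (hab : a + (2 * n + 1) < b ∨ b + (2 * m + 1) < a) :
    ((S a).pos < (S b).pos ↔ (S a).pos < (S (b + (2 * m + 1))).pos) ↔
      ((S (a + (2 * n + 1))).pos < (S b).pos ↔
        (S (a + (2 * n + 1))).pos < (S (b + (2 * m + 1))).pos) := by
  have key := hS.leftInd_corner_sum ha.start hb.start hab
    (fun i h h' => ⟨(leftInd_eq_zero_of_onSide hb.left (ha.inner i h h')).2,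
      (leftInd_eq_zero_of_onSide hb.right (ha.inner i h h')).2⟩)
    (fun i h h' => ⟨(leftInd_eq_zero_of_onSide ha.left (hb.inner i h h')).1,
      (leftInd_eq_zero_of_onSide ha.right (hb.inner i h h')).1⟩)
  rw [leftInd_of_onSide ha.left hb.left, leftInd_of_onSide ha.left hb.right,
    leftInd_of_onSide ha.right hb.left, leftInd_of_onSide ha.right hb.right] at key
  apply iff_of_ite_sum_four
  convert key

omit hS in
theorem exists_ht_bounds (S : ℤ → CState) (a : ℤ) (n : ℕ) :
    ∃ K : ℤ, ∀ i, a ≤ i → i ≤ a + n → (S i).ht ≤ K ∧ - K ≤ (S i).ht := by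
  induction n with
  | zero =>
    refine ⟨|(S a).ht|, fun i h h' => ?_⟩
    obtain rfl : i = a := by push_cast at h'; omega
    exact ⟨le_abs_self _, neg_abs_le _⟩
  | succ n ih =>
    obtain ⟨K, hK⟩ := ih
    refine ⟨max K |(S (a + (n + 1 : ℕ))).ht|, fun i h h' => ?_⟩
    rcases eq_or_ne i (a + (n + 1 : ℕ)) with rfl | hne
    · have h1 := le_abs_self (S (a + (n + 1 : ℕ))).ht
      have h2 := neg_abs_le (S (a + (n + 1 : ℕ))).ht
      have h3 := le_max_right K |(S (a + (n + 1 : ℕ))).ht|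
      constructor <;> linarith
    · have h1 := hK i h (by push_cast at *; omega)
      have h3 := le_max_left K |(S (a + (n + 1 : ℕ))).ht|
      constructor <;> linarith

theorem arc_ray_above {t : Bool} {a b : ℤ} {n : ℕ} (ha : IsArc S t a n) (hb : StripStart (S b))
    (hbt : OnSide t (S b)) (hray : ∀ j, b < j → ¬ OnSide t (S j)) (hab : a + (2 * n + 1) < b) :
    (S a).pos < (S b).pos ↔ (S (a + (2 * n + 1))).pos < (S b).pos := by
  obtain ⟨K, hK⟩ := exists_ht_bounds S a (2 * n + 1)
  obtain ⟨N, hN⟩ := hS.above K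
  obtain ⟨m, hm⟩ : ∃ m : ℕ, N ≤ b + (2 * m + 1) := ⟨(N - b).toNat, by omega⟩
  have hfar : ∀ i, a ≤ i → i ≤ a + (2 * n + 1) → leftInd (S i) (S (b + (2 * m + 1))) = 0 := by
    intro i h h'
    have h1 := hK i h (by push_cast; omega)
    have h2 := hN _ hm
    exact (leftInd_eq_zero_of_ht (by omega)).1
  have key := hS.leftInd_corner_sum (n := n) (m := m) ha.start hb (Or.inl hab)
    (fun i h h' => ⟨(leftInd_eq_zero_of_onSide hbt (ha.inner i h h')).2,
      hfar i (by omega) (by omega)⟩)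
    (fun i h h' => ⟨(leftInd_eq_zero_of_onSide ha.left (hray i h)).1,
      (leftInd_eq_zero_of_onSide ha.right (hray i h)).1⟩)
  rw [hfar _ (by omega) (by omega), hfar _ (by omega) (by omega),
    leftInd_of_onSide ha.left hbt, leftInd_of_onSide ha.right hbt] at key
  by_cases h1 : (S a).pos < (S b).pos <;>
    by_cases h2 : (S (a + (2 * n + 1))).pos < (S b).pos <;>
    first | exact iff_of_true h1 h2 | exact iff_of_false h1 h2 | simp [h1, h2] at key

theorem arc_ray_below {t : Bool} {a e : ℤ} {n : ℕ} (ha : IsArc S t a n)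
    (he : ¬ StripStart (S e)) (het : OnSide t (S e)) (hray : ∀ j, j < e → ¬ OnSide t (S j))
    (hea : e < a) :
    (S a).pos < (S e).pos ↔ (S (a + (2 * n + 1))).pos < (S e).pos := by
  obtain ⟨K, hK⟩ := exists_ht_bounds S a (2 * n + 1)
  obtain ⟨N, hN⟩ := hS.below (- K)
  obtain ⟨m, b, rfl, hm⟩ : ∃ (m : ℕ) (b : ℤ), e = b + (2 * m + 1) ∧ b ≤ N :=
    ⟨(e - N).toNat, e - (2 * (e - N).toNat + 1), by omega, by omega⟩
  have hb : StripStart (S b) := by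
    rwa [hS.stripStart_add_two_mul_succ, not_not] at he
  have hfar : ∀ i, a ≤ i → i ≤ a + (2 * n + 1) → leftInd (S i) (S b) = 0 := by
    intro i h h'
    have h1 := hK i h (by push_cast; omega)
    have h2 := hN _ hm
    exact (leftInd_eq_zero_of_ht (by omega)).1
  have key := hS.leftInd_corner_sum (n := n) (m := m) ha.start hb (Or.inr hea)
    (fun i h h' => ⟨hfar i (by omega) (by omega),
      (leftInd_eq_zero_of_onSide het (ha.inner i h h')).2⟩)
    (fun i h h' => ⟨(leftInd_eq_zero_of_onSide ha.left (hray i h')).1,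
      (leftInd_eq_zero_of_onSide ha.right (hray i h')).1⟩)
  rw [hfar _ (by omega) (by omega), hfar _ (by omega) (by omega),
    leftInd_of_onSide ha.left het, leftInd_of_onSide ha.right het] at key
  by_cases h1 : (S a).pos < (S (b + (2 * m + 1))).pos <;>
    by_cases h2 : (S (a + (2 * n + 1))).pos < (S (b + (2 * m + 1))).pos <;>
    first | exact iff_of_true h1 h2 | exact iff_of_false h1 h2 | simp [h1, h2] at key

end IsLift

/-- `z 0 < ⋯ < z (n - 1)` are the times at which `S` meets the line `y = 0`. -/
structure Crossings (S : ℤ → CState) (n : ℕ) (z : ℕ → ℤ) : Prop where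
  lt : ∀ i j, i < j → j < n → z i < z j
  iff : ∀ k, IsCross0 (S k) ↔ ∃ i < n, z i = k

theorem IsLift.exists_crossings {D : StdDiagram} {S : ℤ → CState} (hS : D.IsLift S) :
    ∃ n z, Crossings S n z := by
  obtain ⟨N, hN⟩ := hS.above 0
  obtain ⟨M, hM⟩ := hS.below 0
  have hfin : {k : ℤ | IsCross0 (S k)}.Finite := by
    apply (Set.finite_Icc M N).subset
    intro k hk
    have hk0 : (S k).ht = 0 := hk.2
    constructor
    · by_contra h
      have := hM k (by omega)
      omega
    · by_contra h
      have := hN k (by omega)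
      omega
  let e := hfin.toFinset.orderEmbOfFin rfl
  refine ⟨hfin.toFinset.card, fun i => if h : i < hfin.toFinset.card then e ⟨i, h⟩ else 0,
    fun i j hij hj => ?_, fun k => ?_⟩
  · have hi : i < hfin.toFinset.card := hij.trans hj
    simp only [hi, hj, dif_pos]
    exact e.strictMono hij
  · have hr := Finset.range_orderEmbOfFin hfin.toFinset rfl
    have hk : IsCross0 (S k) ↔ k ∈ Set.range e := by
      rw [hr]; simp
    rw [hk]
    constructor
    · rintro ⟨i, hi⟩
      exact ⟨i, i.2, by simp [hi]⟩
    · rintro ⟨i, hi, h⟩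
      rw [dif_pos hi] at h
      exact ⟨_, h⟩

namespace Crossings

variable {D} {S : ℤ → CState} {n : ℕ} {z : ℕ → ℤ}

theorem isCross0 (hz : Crossings S n z) {i : ℕ} (hi : i < n) : IsCross0 (S (z i)) :=
  (hz.iff _).2 ⟨i, hi, rfl⟩

theorem lt_iff (hz : Crossings S n z) {i j : ℕ} (hi : i < n) (hj : j < n) :
    z i < z j ↔ i < j := by
  rcases lt_trichotomy i j with h | rfl | h
  · have := hz.lt i j h hj
    omega
  · simp
  · have := hz.lt j i h hi
    omega

theorem not_between (hz : Crossings S n z) {i : ℕ} (hi : i + 1 < n) {k : ℤ} (h1 : z i < k)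
    (h2 : k < z (i + 1)) : ¬ IsCross0 (S k) := by
  rw [hz.iff]
  rintro ⟨j, hj, rfl⟩
  rw [hz.lt_iff (by omega) hj] at h1
  rw [hz.lt_iff hj hi] at h2
  omega

theorem not_after (hz : Crossings S n z) {k : ℤ} (h1 : z (n - 1) < k) : ¬ IsCross0 (S k) := by
  rw [hz.iff]
  rintro ⟨j, hj, rfl⟩
  rw [hz.lt_iff (by omega) hj] at h1
  omega

theorem not_before (hz : Crossings S n z) {k : ℤ} (h1 : k < z 0) : ¬ IsCross0 (S k) := by
  rw [hz.iff]
  rintro ⟨j, hj, rfl⟩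
  rw [hz.lt_iff hj (by omega)] at h1
  omega

end Crossings

theorem strip_step_of_stripStart {σ : CState} (h : StripStart σ) :
    (D.step σ).strip = σ.strip := by
  unfold strip
  rcases D.step_strip h with ⟨h1, h2, h3, -⟩ | ⟨h1, h2, h3, -⟩ | ⟨h1, h2, h3, -⟩ |
    ⟨h1, h2, h3, -⟩ <;> simp [h1, h2, h3]

theorem up_step_of_not_stripStart {σ : CState} (h : ¬ StripStart σ) :
    (D.step σ).up = σ.up := by
  obtain ⟨pos, up, top, ht⟩ := σ
  cases up <;> cases top <;> simp [StripStart] at h <;> simp [step]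

theorem exists_transition {P : ℤ → Prop} {i j : ℤ} (hij : i ≤ j) (hi : P i) (hj : ¬ P j) :
    ∃ k, i ≤ k ∧ k < j ∧ P k ∧ ¬ P (k + 1) := by
  obtain ⟨m, rfl⟩ : ∃ m : ℕ, j = i + m := ⟨(j - i).toNat, by omega⟩
  clear hij
  induction m with
  | zero => simp at hj; exact absurd hi hj
  | succ m ih =>
    by_cases h : P (i + m)
    · refine ⟨i + m, by omega, by push_cast; omega, h, ?_⟩
      push_cast at hj
      rwa [← add_assoc] at hj
    · obtain ⟨k, h1, h2, h3⟩ := ih h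
      exact ⟨k, h1, by push_cast; omega, h3⟩

namespace IsLift

variable {D} {S : ℤ → CState} (hS : D.IsLift S)
include hS

theorem cross_of_leave_above {k : ℤ} (h1 : 0 ≤ (S k).strip) (h2 : ¬ 0 ≤ (S (k + 1)).strip) :
    IsCross0 (S (k + 1)) ∧ (S (k + 1)).up = false := by
  rw [hS.step] at *
  by_cases hs : StripStart (S k)
  · rw [D.strip_step_of_stripStart hs] at h2
    exact absurd h1 h2
  · have hup := D.up_step_of_not_stripStart hs
    obtain ⟨e, ⟨e1, e2, -⟩ | ⟨e1, e2, -⟩⟩ := D.step_cross hs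
    · simp only [strip, e1, e2, if_true] at h1 h2
      simp at h2
      omega
    · simp only [strip, e1, e2, if_true] at h1 h2
      simp at h1
      unfold StripStart at hs
      refine ⟨⟨e2, by omega⟩, ?_⟩
      rw [hup]
      rw [e1] at hs
      simpa using hs

theorem cross_of_enter_above {k : ℤ} (h1 : ¬ 0 ≤ (S k).strip) (h2 : 0 ≤ (S (k + 1)).strip) :
    IsCross0 (S k) ∧ (S k).up = true := by
  rw [hS.step] at *
  by_cases hs : StripStart (S k)
  · rw [D.strip_step_of_stripStart hs] at h2
    exact absurd h2 h1
  · obtain ⟨e, ⟨e1, e2, -⟩ | ⟨e1, e2, -⟩⟩ := D.step_cross hs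
    · simp only [strip, e1, e2, if_true] at h1 h2
      simp at h2
      unfold StripStart at hs
      refine ⟨⟨e1, by omega⟩, ?_⟩
      rw [e1] at hs
      simpa using hs
    · simp only [strip, e1, e2, if_true] at h1 h2
      simp at h1
      omega

omit hS in
theorem strip_of_cross {σ : CState} (h : IsCross0 σ) : σ.strip = -1 := by
  simp [strip, h.1, h.2]

theorem next_of_up {k : ℤ} (h : IsCross0 (S k)) (hu : (S k).up = true) :
    (S (k + 1)).top = false ∧ (S (k + 1)).ht = 0 ∧ (S (k + 1)).up = true ∧
      (S (k + 1)).pos = (S k).pos + D.sz := by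
  have hs : ¬ StripStart (S k) := by simp [StripStart, h.1, hu]
  rw [hS.step, D.up_step_of_not_stripStart hs]
  obtain ⟨e, ⟨e1, e2, e3⟩ | ⟨e1, e2, e3⟩⟩ := D.step_cross hs
  · exact ⟨e2, by rw [e, h.2], hu, e3⟩
  · have := h.1
    simp [e1] at this

theorem prev_of_down {k : ℤ} (h : IsCross0 (S k)) (hu : (S k).up = false) :
    (S (k - 1)).top = false ∧ (S (k - 1)).ht = 0 ∧ (S (k - 1)).up = false ∧
      (S (k - 1)).pos = (S k).pos + D.sz := by
  have hst : S k = D.step (S (k - 1)) := by rw [← hS.step]; congr 1; ring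
  have hs : ¬ StripStart (S (k - 1)) := by
    have h1 : StripStart (S k) := by simp [StripStart, h.1, hu]
    intro h2
    rw [hst, stripStart_step] at h1
    exact h1 h2
  have hup := D.up_step_of_not_stripStart hs
  rw [← hst, hu] at hup
  obtain ⟨e, ⟨e1, e2, e3⟩ | ⟨e1, e2, e3⟩⟩ := D.step_cross hs <;> rw [← hst] at *
  · have := h.1
    simp [e2] at this
  · exact ⟨e1, by rw [← e, h.2], hup.symm, by omega⟩

theorem not_stripStart_sub_one {k : ℤ} (h : StripStart (S k)) : ¬ StripStart (S (k - 1)) := by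
  have hst : S k = D.step (S (k - 1)) := by rw [← hS.step]; congr 1; ring
  rwa [hst, stripStart_step] at h

/-- A state just above the line `y = 0` is next to a state on that line. -/
theorem cross_near_bottom {k : ℤ} (h : OnSide false (S k)) :
    (IsCross0 (S (k - 1)) ∧ (S (k - 1)).up = true) ∨
      (IsCross0 (S (k + 1)) ∧ (S (k + 1)).up = false) := by
  have h1 : (S k).top = false := h.1
  cases hu : (S k).up
  · right
    have hs : ¬ StripStart (S k) := by simp [StripStart, h1, hu]
    rw [hS.step, D.up_step_of_not_stripStart hs]
    obtain ⟨e, ⟨e1, e2, e3⟩ | ⟨e1, e2, e3⟩⟩ := D.step_cross hs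
    · simp [h1] at e1
    · exact ⟨⟨e2, by rw [e, h.2]⟩, hu⟩
  · left
    have hs := hS.not_stripStart_sub_one (k := k) (by simp [StripStart, h1, hu])
    have hst : S k = D.step (S (k - 1)) := by rw [← hS.step]; congr 1; ring
    have hup := D.up_step_of_not_stripStart hs
    rw [← hst, hu] at hup
    obtain ⟨e, ⟨e1, e2, e3⟩ | ⟨e1, e2, e3⟩⟩ := D.step_cross hs <;> rw [← hst] at *
    · exact ⟨⟨e1, by rw [← e, h.2]⟩, hup.symm⟩
    · simp [h1] at e2

theorem strip_succ_of_down {k : ℤ} (h : IsCross0 (S k)) (hu : (S k).up = false) :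
    (S (k + 1)).strip = -1 := by
  rw [hS.step, D.strip_step_of_stripStart, strip_of_cross h]
  simp [StripStart, h.1, hu]

variable {n : ℕ} {z : ℕ → ℤ} (hz : Crossings S n z)
include hz

theorem down_succ_of_up {i : ℕ} (hi : i + 1 < n) (hu : (S (z i)).up = true) :
    (S (z (i + 1))).up = false := by
  have h1 := hS.next_of_up (hz.isCross0 (by omega)) hu
  have h2 : 0 ≤ (S (z i + 1)).strip := by simp [strip, h1.1, h1.2.1]
  have h3 : ¬ 0 ≤ (S (z (i + 1))).strip := by simp [strip_of_cross (hz.isCross0 hi)]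
  have h4 := hz.lt i (i + 1) (by omega) hi
  obtain ⟨k, k1, k2, k3, k4⟩ := exists_transition (P := fun k => 0 ≤ (S k).strip) h4 h2 h3
  obtain ⟨c, hc⟩ := hS.cross_of_leave_above k3 k4
  rcases eq_or_ne (k + 1) (z (i + 1)) with e | e
  · rwa [← e]
  · exact absurd c (hz.not_between hi (by omega) (by omega))

theorem up_succ_of_down {i : ℕ} (hi : i + 1 < n) (hu : (S (z i)).up = false) :
    (S (z (i + 1))).up = true := by
  by_contra hd
  simp only [Bool.not_eq_true] at hd
  have h1 := hS.prev_of_down (hz.isCross0 hi) hd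
  have h2 : ¬ 0 ≤ (S (z i + 1)).strip := by
    rw [hS.strip_succ_of_down (hz.isCross0 (by omega)) hu]; omega
  have h3 : 0 ≤ (S (z (i + 1) - 1)).strip := by simp [strip, h1.1, h1.2.1]
  have h4 := hz.lt i (i + 1) (by omega) hi
  have h5 : z i + 1 ≤ z (i + 1) - 1 := by
    rcases eq_or_ne (z (i + 1) - 1) (z i) with e | e
    · have := (hz.isCross0 (i := i) (by omega)).1
      rw [← e, h1.1] at this
      simp at this
    · omega
  obtain ⟨k, k1, k2, k3, k4⟩ := exists_transition (P := fun k => ¬ 0 ≤ (S k).strip) h5 h2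
    (not_not.2 h3)
  obtain ⟨c, hc⟩ := hS.cross_of_enter_above k3 (not_not.1 k4)
  exact absurd c (hz.not_between hi (by omega) (by omega))

theorem up_first (hn : 0 < n) : (S (z 0)).up = true := by
  by_contra hd
  simp only [Bool.not_eq_true] at hd
  have h1 := hS.prev_of_down (hz.isCross0 hn) hd
  have h3 : 0 ≤ (S (z 0 - 1)).strip := by simp [strip, h1.1, h1.2.1]
  obtain ⟨N, hN⟩ := hS.below 0
  have h2 : ¬ 0 ≤ (S (min N (z 0 - 1))).strip := by
    have := hN _ (min_le_left N (z 0 - 1))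
    unfold strip
    split_ifs <;> omega
  obtain ⟨k, k1, k2, k3, k4⟩ := exists_transition (P := fun k => ¬ 0 ≤ (S k).strip)
    (min_le_right _ _) h2 (not_not.2 h3)
  obtain ⟨c, hc⟩ := hS.cross_of_enter_above k3 (not_not.1 k4)
  exact absurd c (hz.not_before (by omega))

theorem up_last (hn : 0 < n) : (S (z (n - 1))).up = true := by
  by_contra hd
  simp only [Bool.not_eq_true] at hd
  have h2 : ¬ 0 ≤ (S (z (n - 1) + 1)).strip := by
    rw [hS.strip_succ_of_down (hz.isCross0 (by omega)) hd]; omega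
  obtain ⟨N, hN⟩ := hS.above 0
  have h3 : 0 ≤ (S (max N (z (n - 1) + 1))).strip := by
    have := hN _ (le_max_left N (z (n - 1) + 1))
    unfold strip
    split_ifs <;> omega
  obtain ⟨k, k1, k2, k3, k4⟩ := exists_transition (P := fun k => ¬ 0 ≤ (S k).strip)
    (le_max_right _ _) h2 (not_not.2 h3)
  obtain ⟨c, hc⟩ := hS.cross_of_enter_above k3 (not_not.1 k4)
  exact absurd c (hz.not_after (by omega))

theorem up_iff_even {i : ℕ} (hi : i < n) : (S (z i)).up = true ↔ i % 2 = 0 := by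
  induction i with
  | zero => simpa using hS.up_first hz hi
  | succ i ih =>
    have ih' := ih (by omega)
    cases hu : (S (z i)).up
    · rw [hS.up_succ_of_down hz hi hu]
      simp [hu] at ih'
      simp
      omega
    · rw [hS.down_succ_of_up hz hi hu]
      simp [hu] at ih'
      simp
      omega

theorem card_crossings_odd (hn : 0 < n) : n % 2 = 1 := by
  have := (hS.up_iff_even hz (i := n - 1) (by omega)).1 (hS.up_last hz hn)
  omega

theorem isArc_lower {i : ℕ} (hi : i + 1 < n) (hp : i % 2 = 1) :
    ∃ m : ℕ, z (i + 1) = z i + (2 * m + 1) ∧ IsArc S true (z i) m := by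
  have h1 : (S (z i)).up = false := by
    have := hS.up_iff_even hz (i := i) (by omega)
    simpa [hp] using this
  have h2 : (S (z (i + 1))).up = true := (hS.up_iff_even hz hi).2 (by omega)
  have h3 := hz.isCross0 (i := i) (by omega)
  have h4 := hz.isCross0 hi
  have hs : StripStart (S (z i)) := by simp [StripStart, h3.1, h1]
  obtain ⟨m, hm⟩ := hS.exists_odd_of_stripStart (hz.lt i (i + 1) (by omega) hi).le hs
    (by simp [StripStart, h4.1, h2])
  refine ⟨m, hm, hs, h3, hm ▸ h4, fun k hk hk' => ?_⟩
  exact hz.not_between hi hk (by omega)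

theorem isArc_upper {i : ℕ} (hi : i + 1 < n) (hp : i % 2 = 0) :
    ∃ m : ℕ, z (i + 1) - 1 = z i + 1 + (2 * m + 1) ∧ IsArc S false (z i + 1) m := by
  have h1 : (S (z i)).up = true := (hS.up_iff_even hz (by omega)).2 hp
  have h2 : (S (z (i + 1))).up = false := by
    have := hS.up_iff_even hz hi
    simpa [show (i + 1) % 2 = 1 by omega] using this
  obtain ⟨n1, n2, n3, n4⟩ := hS.next_of_up (hz.isCross0 (i := i) (by omega)) h1
  obtain ⟨p1, p2, p3, p4⟩ := hS.prev_of_down (hz.isCross0 hi) h2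
  have hs : StripStart (S (z i + 1)) := by simp [StripStart, n1, n3]
  have hlt := hz.lt i (i + 1) (by omega) hi
  have hlt' : z i + 1 ≤ z (i + 1) - 1 := by
    by_contra h
    have e : z i + 1 = z (i + 1) := by omega
    have := (hz.isCross0 hi).1
    rw [← e, n1] at this
    simp at this
  obtain ⟨m, hm⟩ := hS.exists_odd_of_stripStart hlt' hs (by simp [StripStart, p1, p3])
  refine ⟨m, hm, hs, ⟨n1, n2⟩, hm ▸ ⟨p1, p2⟩, fun k hk hk' h => ?_⟩
  rcases hS.cross_near_bottom h with ⟨h, -⟩ | ⟨h, -⟩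
  · exact hz.not_between hi (by omega) (by omega) h
  · exact hz.not_between hi (by omega) (by omega) h

theorem meander (hn : 0 < n) (γ : ℕ → ℤ)
    (hγ : ∀ i, i + 1 < n → γ (i + 1) = γ i +
      if ((S (z i)).up = true ↔ (S (z i)).pos < (S (z (i + 1))).pos) then 1 else -1) :
    Meander n (fun i => (S (z i)).pos) γ := by
  have hle : ∀ i j, i ≤ j → j < n → z i ≤ z j := by
    intro i j hij hj
    rcases hij.eq_or_lt with rfl | h
    · exact le_rfl
    · exact (hz.lt i j h hj).le
  have hodd := hS.card_crossings_odd hz hn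
  refine ⟨hodd, ?_, ?_, ?_, ?_, ?_⟩
  · intro i j hi hj e
    have ci := hz.isCross0 hi
    have cj := hz.isCross0 hj
    have := hS.inj (z i) (z j) ⟨ci.1.trans cj.1.symm, ci.2.trans cj.2.symm, e⟩
    have h1 := hz.lt_iff hi hj
    have h2 := hz.lt_iff hj hi
    omega
  · intro i hi
    have := hγ i hi
    have hu := hS.up_iff_even hz (i := i) (by omega)
    simp only [hu] at this
    exact this
  · intro i j hi hj hij hp
    have hsep : z (i + 1) < z j ∨ z (j + 1) < z i := by
      rcases lt_or_gt_of_ne hij with h | h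
      · left; exact hz.lt _ _ (by omega) (by omega)
      · right; exact hz.lt _ _ (by omega) (by omega)
    rcases Nat.mod_two_eq_zero_or_one i with h0 | h1
    · obtain ⟨m, e, hm⟩ := hS.isArc_upper hz hi h0
      obtain ⟨l, e', hl⟩ := hS.isArc_upper hz hj (hp ▸ h0)
      have key := hS.arc_arc hm hl (by omega)
      have u1 := (hS.up_iff_even hz (i := i) (by omega)).2 h0
      have u2 := (hS.up_iff_even hz (i := j) (by omega)).2 (hp ▸ h0)
      have u3 : (S (z (i + 1))).up = false := hS.down_succ_of_up hz hi u1
      have u4 : (S (z (j + 1))).up = false := hS.down_succ_of_up hz hj u2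
      rw [← e, ← e', (hS.next_of_up (hz.isCross0 (by omega)) u1).2.2.2,
        (hS.next_of_up (hz.isCross0 (by omega)) u2).2.2.2,
        (hS.prev_of_down (hz.isCross0 hi) u3).2.2.2,
        (hS.prev_of_down (hz.isCross0 hj) u4).2.2.2] at key
      simpa using key
    · obtain ⟨m, e, hm⟩ := hS.isArc_lower hz hi h1
      obtain ⟨l, e', hl⟩ := hS.isArc_lower hz hj (hp ▸ h1)
      have key := hS.arc_arc hm hl (by omega)
      rwa [← e, ← e'] at key
  · intro i hi hp
    obtain ⟨m, e, hm⟩ := hS.isArc_upper hz hi hp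
    have u1 := (hS.up_iff_even hz (i := i) (by omega)).2 hp
    have u3 : (S (z (i + 1))).up = false := hS.down_succ_of_up hz hi u1
    have ul := hS.up_last hz hn
    obtain ⟨n1, n2, n3, n4⟩ := hS.next_of_up (hz.isCross0 (i := n - 1) (by omega)) ul
    have hs : StripStart (S (z (n - 1) + 1)) := by simp [StripStart, n1, n3]
    have key := hS.arc_ray_above hm hs ⟨n1, n2⟩
      (fun j hj h => by
        rcases hS.cross_near_bottom h with ⟨h, hu⟩ | ⟨h, -⟩
        · exact hz.not_after (by omega) h
        · exact hz.not_after (by omega) h)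
      (by have := hle (i + 1) (n - 1) (by omega) (by omega); omega)
    rw [← e, n4, (hS.next_of_up (hz.isCross0 (by omega)) u1).2.2.2,
      (hS.prev_of_down (hz.isCross0 hi) u3).2.2.2] at key
    simpa using key
  · intro i hi hp
    obtain ⟨m, e, hm⟩ := hS.isArc_lower hz hi hp
    have c0 := hz.isCross0 hn
    have key := hS.arc_ray_below hm (e := z 0)
      (by simp [StripStart, c0.1, hS.up_first hz hn]) c0
      (fun j hj => hz.not_before hj) (hz.lt _ _ (by omega) (by omega))
    rwa [← e] at key

end IsLift

section

/-- Reversal as a permutation of the states. -/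
def revPerm : Equiv.Perm CState := ⟨rev, rev, rev_rev, rev_rev⟩

/-- Translation as a permutation of the states. -/
def shiftPerm (x h : ℤ) : Equiv.Perm CState :=
  ⟨shift x h, shift (-x) (-h), fun σ => by simp, fun σ => by simp⟩

/-- The full orbit of the reference starting state. -/
def orbit (i : ℤ) : CState := (D.stepPerm ^ i) start0

/-- Two states project to the same state downstairs. -/
def Congruent (σ τ : CState) : Prop := ∃ x h : ℤ, τ = shift (D.pz * x) h σ

variable {D}

theorem Congruent.up_eq {σ τ : CState} (h : D.Congruent σ τ) : τ.up = σ.up := by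
  obtain ⟨x, h, rfl⟩ := h; rfl

theorem Congruent.top_eq {σ τ : CState} (h : D.Congruent σ τ) : τ.top = σ.top := by
  obtain ⟨x, h, rfl⟩ := h; rfl

theorem Congruent.pos_emod {σ τ : CState} (h : D.Congruent σ τ) :
    τ.pos % D.pz = σ.pos % D.pz := by
  obtain ⟨x, h, rfl⟩ := h; simp [shift]

theorem Congruent.symm {σ τ : CState} (h : D.Congruent σ τ) : D.Congruent τ σ := by
  obtain ⟨x, h, rfl⟩ := h
  exact ⟨-x, -h, by simp⟩

theorem Congruent.trans {σ τ υ : CState} (h : D.Congruent σ τ) (h' : D.Congruent τ υ) :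
    D.Congruent σ υ := by
  obtain ⟨x, h, rfl⟩ := h
  obtain ⟨x', h', rfl⟩ := h'
  exact ⟨x + x', h + h', by simp [mul_add]⟩

variable (D)

theorem congruent_of_eq {σ τ : CState} (h1 : σ.up = τ.up) (h2 : σ.top = τ.top)
    (h3 : σ.pos % D.pz = τ.pos % D.pz) : D.Congruent σ τ := by
  refine ⟨τ.pos / D.pz - σ.pos / D.pz, τ.ht - σ.ht, ?_⟩
  have e1 := Int.emod_add_mul_ediv σ.pos D.pz
  have e2 := Int.emod_add_mul_ediv τ.pos D.pz
  ext
  · simp only [shift]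
    rw [mul_sub]
    omega
  · exact h1.symm
  · exact h2.symm
  · simp [shift]

theorem zpow_shift (i x h : ℤ) (σ : CState) :
    (D.stepPerm ^ i) (shift (D.pz * x) h σ) = shift (D.pz * x) h ((D.stepPerm ^ i) σ) := by
  have hc : Commute D.stepPerm (shiftPerm (D.pz * x) h) :=
    Equiv.ext fun τ => D.step_shift x h τ
  exact congrArg (fun e : Equiv.Perm CState => e σ) (hc.zpow_left i)

theorem zpow_rev (i : ℤ) (σ : CState) :
    (D.stepPerm ^ i) (rev σ) = rev ((D.stepPerm ^ (-i)) σ) := by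
  have hc : revPerm * D.stepPerm * revPerm⁻¹ = D.stepPerm⁻¹ := by
    ext1 τ
    exact (D.stepB_eq τ).symm
  have h := conj_zpow (a := revPerm) (b := D.stepPerm) (i := i)
  rw [hc, inv_zpow, ← zpow_neg] at h
  rw [h]
  exact (rev_rev _).symm

theorem orbit_add (i j : ℤ) : D.orbit (i + j) = (D.stepPerm ^ i) (D.orbit j) := by
  rw [orbit, zpow_add]; rfl

theorem orbit_succ (i : ℤ) : D.orbit (i + 1) = D.step (D.orbit i) := by
  rw [add_comm, orbit_add, zpow_one]; rfl

theorem orbit_natCast (n : ℕ) : D.orbit n = (D.step)^[n] start0 := by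
  induction n with
  | zero => rfl
  | succ n ih => rw [Nat.cast_succ, orbit_succ, ih, Function.iterate_succ_apply']

variable {D} in
theorem Congruent.zpow {σ τ : CState} (h : D.Congruent σ τ) (i : ℤ) :
    D.Congruent ((D.stepPerm ^ i) σ) ((D.stepPerm ^ i) τ) := by
  obtain ⟨x, h, rfl⟩ := h
  exact ⟨x, h, D.zpow_shift i x h σ⟩

/-- The first return of the orbit to the reference starting state downstairs. -/
theorem exists_period : ∃ L : ℤ, 0 < L ∧ D.Congruent start0 (D.orbit L) ∧
    ∀ k, 0 < k → D.Congruent start0 (D.orbit k) → L ≤ k := by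
  have hex : ∃ n : ℕ, 0 < n ∧ D.Congruent start0 (D.orbit n) := by
    let T := Finset.Ico (0 : ℤ) D.pz
    have hT : ∀ i : ℕ, (D.orbit i).pos % D.pz ∈ T := fun i =>
      Finset.mem_Ico.2 ⟨Int.emod_nonneg _ D.pz_pos.ne', Int.emod_lt_of_pos _ D.pz_pos⟩
    obtain ⟨i, j, hij, e⟩ := Finite.exists_ne_map_eq_of_infinite
      (fun i : ℕ => ((D.orbit i).up, (D.orbit i).top, (⟨_, hT i⟩ : T)))
    simp only [Prod.mk.injEq, Subtype.mk.injEq] at e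
    have main : ∀ i j : ℕ, i < j → D.Congruent (D.orbit i) (D.orbit j) →
        ∃ n : ℕ, 0 < n ∧ D.Congruent start0 (D.orbit n) := by
      intro i j hij h
      refine ⟨j - i, by omega, ?_⟩
      have h' := h.zpow (-i)
      rw [← orbit_add, ← orbit_add] at h'
      convert h' using 1
      · rw [neg_add_cancel]; rfl
      · congr 1; omega
    have hc := D.congruent_of_eq e.1 e.2.1 e.2.2
    rcases lt_or_gt_of_ne hij with h | h
    · exact main i j h hc
    · exact main j i h hc.symm
  refine ⟨Nat.find hex, by exact_mod_cast (Nat.find_spec hex).1, (Nat.find_spec hex).2,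
    fun k hk h => ?_⟩
  obtain ⟨k, rfl⟩ := Int.eq_ofNat_of_zero_le hk.le
  exact_mod_cast Nat.find_min' hex ⟨by exact_mod_cast hk, h⟩

theorem not_congruent_rev_step (σ : CState) : ¬ D.Congruent (D.step σ) (rev σ) := by
  intro h
  have h1 := h.up_eq
  have h2 := h.top_eq
  have h3 := h.pos_emod
  simp only [rev] at h1 h2 h3
  by_cases hs : StripStart σ
  · have hp := D.pz_pos
    have hq : 0 ≤ D.qz := by unfold qz; omega
    have hr : 0 ≤ D.rz := by unfold rz; omega
    have hpqr : 2 * D.qz + D.rz ≤ D.pz := by have := D.h2qr; unfold pz qz rz; omega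
    rw [Int.emod_eq_emod_iff_emod_sub_eq_zero] at h3
    obtain ⟨t, ht⟩ := Int.dvd_of_emod_eq_zero h3
    have small : ∀ d : ℤ, d = D.pz * t → d % 2 = 1 → -D.pz < d → d < D.pz → False := by
      intro d hd hodd h1 h2
      have : t = 0 := by
        by_contra h0
        rcases lt_or_gt_of_ne h0 with h | h <;> nlinarith
      subst this
      omega
    rcases D.step_strip hs with ⟨-, -, -, k, m, a, b, c, d⟩ | ⟨-, -, -, k, m, a, b, c, d⟩ |
      ⟨a, b, -⟩ | ⟨a, b, -⟩
    · exact small _ ht (by omega) (by omega) (by omega)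
    · exact small _ ht (by omega) (by omega) (by omega)
    · simp [a, b] at h2
    · simp [a, b] at h2
  · rw [D.up_step_of_not_stripStart hs] at h1
    simp at h1

/-- The orbit passes through each intersection point downstairs in one direction only. -/
theorem not_congruent_rev_orbit (i j : ℤ) : ¬ D.Congruent (D.orbit i) (rev (D.orbit j)) := by
  intro h
  have hk : ∀ k : ℤ, D.Congruent (D.orbit (k + i)) (rev (D.orbit (-k + j))) := by
    intro k
    rw [orbit_add, orbit_add, ← zpow_rev]
    exact h.zpow k
  rcases Int.emod_two_eq_zero_or_one (j - i) with e | e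
  · have := hk ((j - i) / 2)
    rw [show -((j - i) / 2) + j = (j - i) / 2 + i by omega] at this
    have := this.up_eq
    simp [rev] at this
  · have := hk ((j - i + 1) / 2)
    rw [show (j - i + 1) / 2 + i = (-((j - i + 1) / 2) + j) + 1 by omega, orbit_succ] at this
    exact D.not_congruent_rev_step _ this

theorem congruent_orbit_of_top {i j : ℤ} (hi : (D.orbit i).top = true)
    (hj : (D.orbit j).top = true) (h : (D.orbit i).pos % D.pz = (D.orbit j).pos % D.pz) :
    D.Congruent (D.orbit i) (D.orbit j) := by
  by_cases hu : (D.orbit i).up = (D.orbit j).up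
  · exact D.congruent_of_eq hu (hi.trans hj.symm) h
  · refine absurd (D.congruent_of_eq (τ := rev (D.orbit j)) ?_ (hi.trans hj.symm) h)
      (D.not_congruent_rev_orbit i j)
    cases h1 : (D.orbit i).up <;> cases h2 : (D.orbit j).up <;> simp_all [rev]

theorem shift_of_add_mul {S : ℤ → CState} {L x h : ℤ}
    (hS : ∀ i, S (i + L) = shift (D.pz * x) h (S i)) (i k : ℤ) :
    S (i + L * k) = shift (D.pz * (x * k)) (h * k) (S i) := by
  induction k with
  | zero => simp
  | succ k ih =>
    rw [show i + L * ((k : ℤ) + 1) = i + L * k + L by ring, hS, ih, shift_shift]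
    congr 1 <;> ring
  | pred k ih =>
    have := hS (i + L * (-(k : ℤ) - 1))
    rw [show i + L * (-(k : ℤ) - 1) + L = i + L * -k by ring, ih] at this
    have e := congrArg (shift (-(D.pz * x)) (-h)) this
    rw [shift_shift, shift_shift] at e
    simp only [add_neg_cancel, shift_zero] at e
    rw [← e]
    congr 1 <;> ring

/-- `L` is the length of the closed curve `β`, of displacement `(p x, h)`. -/
structure IsPeriod (L x h : ℤ) : Prop where
  pos : 0 < L
  orbit_add : ∀ i, D.orbit (i + L) = shift (D.pz * x) h (D.orbit i)
  dvd : ∀ i j, D.Congruent (D.orbit i) (D.orbit j) → L ∣ i - j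

theorem exists_isPeriod : ∃ L x h, D.IsPeriod L x h := by
  obtain ⟨L, hL, ⟨x, h, e⟩, hmin⟩ := D.exists_period
  have hadd : ∀ i, D.orbit (i + L) = shift (D.pz * x) h (D.orbit i) := by
    intro i
    rw [orbit_add, e, zpow_shift]; rfl
  refine ⟨L, x, h, hL, hadd, ?_⟩
  have hmul : ∀ (k i : ℤ), D.Congruent (D.orbit i) (D.orbit (i + L * k)) := by
    intro k
    induction k with
    | zero => intro i; exact ⟨0, 0, by simp⟩
    | succ k ih =>
      intro i
      refine (ih i).trans ⟨x, h, ?_⟩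
      rw [← hadd]; congr 1; ring
    | pred k ih =>
      intro i
      refine (ih i).trans (Congruent.symm ⟨x, h, ?_⟩)
      rw [← hadd]; congr 1; ring
  intro i j hij
  have h1 := hij.zpow (-i)
  rw [← orbit_add, ← orbit_add, neg_add_cancel] at h1
  have h2 := h1.trans (hmul (-((-i + j) / L)) _)
  have e1 : -i + j + L * -((-i + j) / L) = (-i + j) % L := by
    have := Int.emod_add_mul_ediv (-i + j) L
    linarith
  rw [e1] at h2
  rcases (Int.emod_nonneg (-i + j) hL.ne').eq_or_lt with h3 | h3
  · obtain ⟨t, ht⟩ := Int.dvd_of_emod_eq_zero h3.symm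
    exact ⟨-t, by linarith⟩
  · have := hmin _ h3 h2
    have := Int.emod_lt_of_pos (-i + j) hL
    omega

variable {D}

namespace IsPeriod

variable {L x h : ℤ} (hL : D.IsPeriod L x h)
include hL

theorem orbit_add_mul (i k : ℤ) :
    D.orbit (i + L * k) = shift (D.pz * (x * k)) (h * k) (D.orbit i) :=
  D.shift_of_add_mul hL.orbit_add i k

theorem congruent_emod (i : ℤ) : D.Congruent (D.orbit i) (D.orbit (i % L)) := by
  refine ⟨x * (-(i / L)), h * (-(i / L)), ?_⟩
  rw [← hL.orbit_add_mul]
  congr 1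
  have := Int.emod_add_mul_ediv i L
  linarith

theorem upAt_iff {i : ℤ} (hi : (D.orbit i).top = true) {k : ℤ}
    (hk : (D.orbit i).pos % D.pz = k % D.pz) : D.UpAt k ↔ (D.orbit i).up = true := by
  constructor
  · rintro ⟨n, h1, h2, h3⟩
    rw [← orbit_natCast] at h1 h2 h3
    rw [(D.congruent_orbit_of_top h1 hi (h2.trans hk.symm)).up_eq, h3]
  · intro hu
    have hc := hL.congruent_emod i
    obtain ⟨n, hn⟩ := Int.eq_ofNat_of_zero_le (Int.emod_nonneg i hL.pos.ne')
    rw [hn] at hc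
    refine ⟨n, ?_⟩
    rw [← orbit_natCast]
    exact ⟨hc.top_eq.trans hi, hc.pos_emod.trans hk, hc.up_eq.trans hu⟩

omit hL in
/-- A modified height, which changes by the sign of the crossing at each crossing with `α`. -/
theorem height_step (σ : CState) :
    (D.step σ).ht + (if (D.step σ).top = true ∧ (D.step σ).up = true then 0 else 1)
      = σ.ht + (if σ.top = true ∧ σ.up = true then 0 else 1)
        + if σ.top = true then (if σ.up = true then 1 else -1) else 0 := by
  obtain ⟨pos, up, top, ht⟩ := σ
  cases up <;> cases top <;> simp only [step] <;> simp <;> (try split_ifs) <;> simp_all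

theorem height_eq_algInt (hconn : D.Connected) : h = D.algInt := by
  have htel : ∀ n : ℕ, (D.orbit n).ht
      + (if (D.orbit n).top = true ∧ (D.orbit n).up = true then 0 else 1)
      = 1 + ∑ i ∈ Finset.range n,
        if (D.orbit i).top = true then (if (D.orbit i).up = true then (1 : ℤ) else -1) else 0 := by
    intro n
    induction n with
    | zero => rfl
    | succ n ih =>
      rw [Nat.cast_succ, orbit_succ, height_step, ih, Finset.sum_range_succ, add_assoc]
  obtain ⟨n, rfl⟩ := Int.eq_ofNat_of_zero_le hL.pos.le
  have hn := htel n
  have h0 := hL.orbit_add 0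
  rw [zero_add] at h0
  have e0 : D.orbit 0 = start0 := rfl
  rw [h0, e0] at hn
  simp only [shift, start0, Bool.false_eq_true, and_false, if_false] at hn
  have hh : h = ∑ i ∈ Finset.range n,
      if (D.orbit i).top = true then (if (D.orbit i).up = true then (1 : ℤ) else -1) else 0 := by
    linarith
  rw [hh, ← Finset.sum_filter, algInt]
  have hnn : ∀ i : ℤ, 0 ≤ (D.orbit i).pos % D.pz := fun i => Int.emod_nonneg _ D.pz_pos.ne'
  have hlt : ∀ i : ℤ, (D.orbit i).pos % D.pz < D.pz := fun i => Int.emod_lt_of_pos _ D.pz_pos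
  have hpz : D.pz = (D.p : ℤ) := rfl
  refine Finset.sum_bij (fun i _ => ((D.orbit i).pos % D.pz).toNat) ?_ ?_ ?_ ?_
  · intro i _
    have h1 := hnn i
    have h2 := hlt i
    rw [Finset.mem_range]
    omega
  · intro i hi j hj e
    rw [Finset.mem_filter, Finset.mem_range] at hi hj
    have h1 := hnn i
    have h2 := hnn j
    have := hL.dvd _ _ (D.congruent_orbit_of_top hi.2 hj.2 (by omega))
    have := Int.eq_zero_of_abs_lt_dvd this (by rw [abs_lt]; omega)
    omega
  · intro k hk
    obtain ⟨m, h1, h2⟩ := hconn k (Finset.mem_range.1 hk)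
    rw [← orbit_natCast] at h1 h2
    have hc := hL.congruent_emod m
    have h3 := Int.emod_nonneg m hL.pos.ne'
    have h4 := Int.emod_lt_of_pos m hL.pos
    obtain ⟨l, hl⟩ := Int.eq_ofNat_of_zero_le h3
    rw [hl] at hc h4
    refine ⟨l, Finset.mem_filter.2 ⟨Finset.mem_range.2 (by omega), hc.top_eq.trans h1⟩, ?_⟩
    have := hc.pos_emod.trans h2
    omega
  · intro i hi
    rw [Finset.mem_filter] at hi
    have h1 := hnn i
    have := hL.upAt_iff hi.2 (k := (((D.orbit i).pos % D.pz).toNat : ℤ)) (by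
      rw [Int.toNat_of_nonneg h1, Int.emod_emod])
    simp only [this]

end IsPeriod

end

section

/-- The state for the reference orientation of `β` which corresponds to a state for the
orientation with `α · β > 0`, and conversely. -/
def norm (σ : CState) : CState := if 0 < D.algInt then σ else rev σ

@[simp] theorem norm_norm (σ : CState) : D.norm (D.norm σ) = σ := by
  unfold norm; split_ifs <;> simp

@[simp] theorem norm_pos (σ : CState) : (D.norm σ).pos = σ.pos := by
  unfold norm; split_ifs <;> rfl

@[simp] theorem isCross0_norm (σ : CState) : IsCross0 (D.norm σ) ↔ IsCross0 σ := by
  unfold norm; split_ifs <;> rfl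

theorem norm_shift (x h : ℤ) (σ : CState) :
    D.norm (shift x h σ) = shift x h (D.norm σ) := by
  unfold norm; split_ifs <;> rfl

theorem trueUp_norm (σ : CState) : D.TrueUp (D.norm σ) ↔ σ.up = true := by
  unfold norm TrueUp; split_ifs with h <;> simp [h, rev]

theorem fstep_norm (σ : CState) : D.fstep (D.norm σ) = D.norm (D.step σ) := by
  unfold fstep norm; split_ifs
  · rfl
  · rw [stepB_eq, rev_rev]

theorem upAt_congr {k l : ℤ} (h : k % D.pz = l % D.pz) : D.UpAt k ↔ D.UpAt l := by
  unfold UpAt; rw [h]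

/-- A bi-infinite traversal of a lift of `β`, for the orientation with `α · β > 0`: it is
invariant under a translation of positive height. -/
structure PeriodicLift (S : ℤ → CState) (L X H : ℤ) : Prop where
  step : ∀ i, S (i + 1) = D.step (S i)
  period_pos : 0 < L
  height_pos : 0 < H
  add_period : ∀ i, S (i + L) = shift (D.pz * X) H (S i)
  dvd : ∀ i j, (S i).top = true → (S j).top = true →
    (S i).pos % D.pz = (S j).pos % D.pz → L ∣ i - j
  up_iff : ∀ i, (S i).top = true →
    ((S i).up = true ↔ (0 < D.algInt ↔ D.UpAt (S i).pos))
  cover : ∀ k < D.p, ∃ i, (S i).top = true ∧ (S i).pos % D.pz = k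

theorem exists_periodicLift (hconn : D.Connected) (hA : D.algInt ≠ 0) :
    ∃ S L X H, D.PeriodicLift S L X H := by
  obtain ⟨L, x, h, hL⟩ := D.exists_isPeriod
  have hh := hL.height_eq_algInt hconn
  by_cases hpos : 0 < D.algInt
  · refine ⟨D.orbit, L, x, h, D.orbit_succ, hL.pos, by omega, hL.orbit_add,
      fun i j hi hj e => hL.dvd _ _ (D.congruent_orbit_of_top hi hj e), fun i hi => ?_,
      fun k hk => ?_⟩
    · simp [hpos, hL.upAt_iff hi rfl]
    · obtain ⟨n, h1, h2⟩ := hconn k hk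
      exact ⟨n, by rw [orbit_natCast]; exact ⟨h1, h2⟩⟩
  · refine ⟨fun i => rev (D.orbit (-i)), L, -x, -h, fun i => ?_, hL.pos, by omega, fun i => ?_,
      fun i j hi hj e => ?_, fun i hi => ?_, fun k hk => ?_⟩
    · have e : D.orbit (-i) = D.step (D.orbit (-(i + 1))) := by
        rw [← orbit_succ]; congr 1; ring
      have e2 := D.stepB_eq (D.orbit (-i))
      rw [e, stepB_step] at e2
      rw [e2, rev_rev, ← e]
    · have e := hL.orbit_add_mul (-i) (-1)
      rw [show -(i + L) = -i + L * -1 by ring, e, rev_shift]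
      congr 1 <;> ring
    · have := hL.dvd _ _ (D.congruent_orbit_of_top (i := -i) (j := -j) hi hj e)
      rwa [← dvd_neg, show -(i - j) = -i - -j by ring]
    · have := hL.upAt_iff (i := -i) hi rfl
      simp [hpos, rev, this]
    · obtain ⟨n, h1, h2⟩ := hconn k hk
      refine ⟨-n, ?_⟩
      simp only [neg_neg, orbit_natCast]
      exact ⟨h1, h2⟩

variable {D}

namespace PeriodicLift

variable {S : ℤ → CState} {L X H : ℤ} (hS : D.PeriodicLift S L X H)
include hS

theorem translate (m x h : ℤ) :
    D.PeriodicLift (fun i => shift (D.pz * x) h (S (i + m))) L X H where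
  step i := by
    rw [step_shift, ← hS.step]; congr 2; ring
  period_pos := hS.period_pos
  height_pos := hS.height_pos
  add_period i := by
    rw [shift_shift, add_right_comm, hS.add_period, shift_shift]
    congr 1 <;> ring
  dvd i j hi hj e := by
    have := hS.dvd (i + m) (j + m) hi hj (by simpa [shift] using e)
    simpa using this
  up_iff i hi := by
    have := hS.up_iff (i + m) hi
    rw [D.upAt_congr (k := (shift (D.pz * x) h (S (i + m))).pos) (l := (S (i + m)).pos)
      (by simp [shift])]
    exact this
  cover k hk := by
    obtain ⟨i, h1, h2⟩ := hS.cover k hk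
    refine ⟨i - m, ?_⟩
    simpa [shift] using ⟨h1, h2⟩

theorem add_period_mul (i k : ℤ) :
    S (i + L * k) = shift (D.pz * (X * k)) (H * k) (S i) :=
  D.shift_of_add_mul hS.add_period i k

theorem ht_eq (i : ℤ) : (S i).ht = (S (i % L)).ht + H * (i / L) := by
  have := hS.add_period_mul (i % L) (i / L)
  rw [Int.emod_add_mul_ediv] at this
  rw [this]; rfl

theorem eq_of_top {i j : ℤ} (hi : (S i).top = true) (hj : (S j).top = true)
    (hh : (S i).ht = (S j).ht) (hp : (S i).pos % D.pz = (S j).pos % D.pz) : i = j := by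
  obtain ⟨k, hk⟩ := hS.dvd i j hi hj hp
  have e := hS.add_period_mul j k
  rw [← hk, add_sub_cancel] at e
  have e' := congrArg CState.ht e
  simp only [shift] at e'
  have : H * k = 0 := by omega
  rcases mul_eq_zero.1 this with h | h
  · have := hS.height_pos; omega
  · rw [h] at hk; omega

theorem bottom_up {i : ℤ} (hi : (S i).top = false) (hu : (S i).up = true) :
    (S (i - 1)).top = true ∧ (S (i - 1)).up = true ∧ (S (i - 1)).ht = (S i).ht ∧
      (S (i - 1)).pos = (S i).pos - D.sz := by
  have e : S (i - 1) = D.stepB (S i) := by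
    have := hS.step (i - 1)
    rw [sub_add_cancel] at this
    rw [this, stepB_step]
  rw [e]
  simp [stepB, hi, hu]

theorem bottom_down {i : ℤ} (hi : (S i).top = false) (hu : (S i).up = false) :
    (S (i + 1)).top = true ∧ (S (i + 1)).up = false ∧ (S (i + 1)).ht = (S i).ht ∧
      (S (i + 1)).pos = (S i).pos - D.sz := by
  rw [hS.step]
  simp [StdDiagram.step, hi, hu]

theorem isLift : D.IsLift S where
  step := hS.step
  inj := by
    have aux : ∀ i, (S i).top = false → ∃ j, (S j).top = true ∧ (S j).up = (S i).up ∧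
        (S j).ht = (S i).ht ∧ (S j).pos = (S i).pos - D.sz ∧
        j = if (S i).up = true then i - 1 else i + 1 := by
      intro i hi
      cases hu : (S i).up
      · exact ⟨_, (hS.bottom_down hi hu).1, (hS.bottom_down hi hu).2.1,
          (hS.bottom_down hi hu).2.2.1, (hS.bottom_down hi hu).2.2.2, by simp⟩
      · exact ⟨_, (hS.bottom_up hi hu).1, (hS.bottom_up hi hu).2.1,
          (hS.bottom_up hi hu).2.2.1, (hS.bottom_up hi hu).2.2.2, by simp⟩
    rintro i j ⟨h1, h2, h3⟩
    cases hi : (S i).top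
    · obtain ⟨i', a1, a2, a3, a4, a5⟩ := aux i hi
      obtain ⟨j', b1, b2, b3, b4, b5⟩ := aux j (h1 ▸ hi)
      obtain rfl := hS.eq_of_top a1 b1 (by omega) (by rw [a4, b4, h3])
      rw [← a2] at a5
      rw [← b2] at b5
      split_ifs at a5 b5 <;> omega
    · exact hS.eq_of_top hi (h1 ▸ hi) h2 (by rw [h3])
  above K := by
    obtain ⟨B, hB⟩ := IsLift.exists_ht_bounds S 0 L.toNat
    have hL := hS.period_pos
    have hH := hS.height_pos
    refine ⟨L * (|K + B| + 1), fun i hi => ?_⟩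
    rw [hS.ht_eq]
    have h1 := Int.emod_nonneg i hL.ne'
    have h2 := Int.emod_lt_of_pos i hL
    have h3 := (hB (i % L) h1 (by omega)).2
    have h4 : |K + B| + 1 ≤ i / L := by
      rw [Int.le_ediv_iff_mul_le hL]; linarith
    have h5 := le_abs_self (K + B)
    have h6 := abs_nonneg (K + B)
    nlinarith
  below K := by
    obtain ⟨B, hB⟩ := IsLift.exists_ht_bounds S 0 L.toNat
    have hL := hS.period_pos
    have hH := hS.height_pos
    refine ⟨L * -(|K - B| + 1), fun i hi => ?_⟩
    rw [hS.ht_eq]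
    have h1 := Int.emod_nonneg i hL.ne'
    have h2 := Int.emod_lt_of_pos i hL
    have h3 := (hB (i % L) h1 (by omega)).1
    have h4 : i / L ≤ -(|K - B| + 1) := by
      have := Int.mul_ediv_self_le (x := i) (k := L) hL.ne'
      by_contra hcon
      push Not at hcon
      nlinarith
    have h5 := neg_abs_le (K - B)
    have h6 := abs_nonneg (K - B)
    nlinarith

theorem iterate_fstep (i : ℤ) (n : ℕ) :
    (D.fstep)^[n] (D.norm (S i)) = D.norm (S (i + n)) := by
  induction n with
  | zero => simp
  | succ n ih =>
    rw [Function.iterate_succ_apply', ih, fstep_norm, ← hS.step]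
    congr 2; push_cast; ring

/-- The canonical state at a crossing is a translate of the crossing. -/
theorem spt_eq {i : ℤ} (hi : (S i).top = true) {k : ℕ} (hk : (S i).pos % D.pz = k) :
    D.spt k = D.norm (shift (D.pz * -((S i).pos / D.pz)) (-(S i).ht) (S i)) := by
  have h1 := Int.emod_add_mul_ediv (S i).pos D.pz
  have h2 := hS.up_iff i hi
  have hlt := Int.emod_lt_of_pos (S i).pos D.pz_pos
  have hnn := Int.emod_nonneg (S i).pos D.pz_pos.ne'
  rw [D.upAt_congr (l := (k : ℤ)) (by rw [← hk, Int.emod_emod])] at h2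
  unfold norm spt
  split_ifs with h3 h4 h4 <;> ext <;> simp only [shift, rev] <;> first | linarith | simp_all

end PeriodicLift

/-- Every intersection point on the line `y = 0` lies on a periodic lift. -/
theorem exists_periodicLift_through (hconn : D.Connected) (hA : D.algInt ≠ 0) {c : ℕ}
    (hc : c < D.p) :
    ∃ S L X H, D.PeriodicLift S L X H ∧ S 0 = D.norm (D.spt c) := by
  obtain ⟨S, L, X, H, hS⟩ := D.exists_periodicLift hconn hA
  obtain ⟨i, h1, h2⟩ := hS.cover c hc
  refine ⟨_, L, X, H, hS.translate i (-((S i).pos / D.pz)) (-(S i).ht), ?_⟩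
  rw [hS.spt_eq h1 h2, norm_norm, zero_add]

end

section

/-- The label downstairs of the `m`-th crossing. -/
def crossLab (S : ℤ → CState) (z : ℕ → ℤ) (m : ℕ) : ℕ := ((S (z m)).pos % D.pz).toNat

theorem natCast_crossLab (S : ℤ → CState) (z : ℕ → ℤ) (m : ℕ) :
    (D.crossLab S z m : ℤ) = (S (z m)).pos % D.pz :=
  Int.toNat_of_nonneg (Int.emod_nonneg _ D.pz_pos.ne')

theorem crossLab_lt (S : ℤ → CState) (z : ℕ → ℤ) (m : ℕ) : D.crossLab S z m < D.p := by
  have h1 := D.natCast_crossLab S z m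
  have h2 := Int.emod_lt_of_pos (S (z m)).pos D.pz_pos
  rw [← h1] at h2
  exact Int.ofNat_lt.1 h2

variable {D}

namespace PeriodicLift

variable {S : ℤ → CState} {L X H : ℤ} (hS : D.PeriodicLift S L X H)
include hS

theorem iterate_fstep_shift (i a : ℤ) (k : ℕ) :
    (D.fstep)^[k] (shift (D.pz * a) 0 (D.norm (S i))) =
      shift (D.pz * a) 0 (D.norm (S (i + k))) := by
  have := (hS.translate 0 a 0).iterate_fstep i k
  simpa only [norm_shift, add_zero] using this

variable {n : ℕ} {z : ℕ → ℤ} (hz : Crossings S n z)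
include hz

theorem crossLab_inj {i j : ℕ} (hi : i < n) (hj : j < n)
    (h : D.crossLab S z i = D.crossLab S z j) : i = j := by
  have e : z i = z j := hS.eq_of_top (hz.isCross0 hi).1 (hz.isCross0 hj).1
    ((hz.isCross0 hi).2.trans (hz.isCross0 hj).2.symm)
    (by rw [← natCast_crossLab, ← natCast_crossLab, h])
  have h1 := hz.lt_iff hi hj
  have h2 := hz.lt_iff hj hi
  omega

theorem spt_crossLab {m : ℕ} (hm : m < n) :
    D.spt (D.crossLab S z m) =
      shift (D.pz * -((S (z m)).pos / D.pz)) 0 (D.norm (S (z m))) := by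
  rw [hS.spt_eq (hz.isCross0 hm).1 (D.natCast_crossLab S z m).symm, (hz.isCross0 hm).2,
    norm_shift, neg_zero]

theorem isCross0_iterate_spt {m : ℕ} (hm : m < n) (k : ℕ) :
    IsCross0 ((D.fstep)^[k] (D.spt (D.crossLab S z m))) ↔ IsCross0 (S (z m + k)) := by
  rw [hS.spt_crossLab hz hm, hS.iterate_fstep_shift, ← isCross0_norm D (S (z m + k))]
  simp [IsCross0, shift]

theorem returns0_iff {m : ℕ} (hm : m < n) :
    D.Returns0 (D.spt (D.crossLab S z m)) ↔ m + 1 < n := by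
  constructor
  · rintro ⟨k, hk, h⟩
    rw [hS.isCross0_iterate_spt hz hm, hz.iff] at h
    obtain ⟨j, hj, e⟩ := h
    have := (hz.lt_iff hm hj).1 (by omega)
    omega
  · intro h
    have h1 := hz.lt m (m + 1) (by omega) h
    refine ⟨(z (m + 1) - z m).toNat, by omega, ?_⟩
    rw [hS.isCross0_iterate_spt hz hm, hz.iff]
    exact ⟨m + 1, h, by omega⟩

theorem nxt0_shift {m : ℕ} (hm : m < n) (a : ℤ) :
    D.nxt0 (shift (D.pz * a) 0 (D.norm (S (z m)))) =
      shift (D.pz * a) 0 (D.norm (S (z (min (m + 1) (n - 1))))) := by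
  have hc : ∀ k : ℕ, IsCross0 ((D.fstep)^[k] (shift (D.pz * a) 0 (D.norm (S (z m))))) ↔
      IsCross0 (S (z m + k)) := by
    intro k
    rw [hS.iterate_fstep_shift, ← isCross0_norm D (S (z m + k))]
    simp [IsCross0, shift]
  rw [nxt0, hS.iterate_fstep_shift]
  congr 3
  rw [ret0Steps]
  simp only [hc]
  by_cases h : m + 1 < n
  · have h1 := hz.lt m (m + 1) (by omega) h
    have h2 : sInf {k : ℕ | 1 ≤ k ∧ IsCross0 (S (z m + k))} = (z (m + 1) - z m).toNat := by
      refine IsLeast.csInf_eq ⟨⟨by omega, ?_⟩, ?_⟩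
      · rw [hz.iff]
        exact ⟨m + 1, h, by omega⟩
      · rintro k ⟨hk, hk'⟩
        by_contra hlt
        exact hz.not_between h (k := z m + k) (by omega) (by omega) hk'
    rw [h2, min_eq_left (by omega)]
    omega
  · have h2 : {k : ℕ | 1 ≤ k ∧ IsCross0 (S (z m + k))} = ∅ := by
      ext k
      simp only [Set.mem_ofPred_eq, Set.mem_empty_iff_false, iff_false, not_and]
      intro hk
      obtain rfl : m = n - 1 := by omega
      exact hz.not_after (by omega)
    rw [h2, Nat.sInf_empty, min_eq_right (by omega)]
    obtain rfl : m = n - 1 := by omega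
    simp

theorem seqSt_crossLab {m : ℕ} (hm : m < n) (k : ℕ) :
    D.seqSt (D.crossLab S z m) k =
      shift (D.pz * -((S (z m)).pos / D.pz)) 0 (D.norm (S (z (min (m + k) (n - 1))))) := by
  induction k with
  | zero =>
    rw [add_zero, min_eq_left (by omega), ← hS.spt_crossLab hz hm]; rfl
  | succ k ih =>
    rw [seqSt, Function.iterate_succ_apply', ← seqSt, ih, hS.nxt0_shift hz (by omega)]
    congr 4
    omega

theorem labAt_crossLab {m : ℕ} (hm : m < n) (k : ℕ) :
    D.labAt (D.crossLab S z m) k = D.crossLab S z (min (m + k) (n - 1)) := by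
  rw [labAt, hS.seqSt_crossLab hz hm, natCast_crossLab]
  simp [lab, shift]

theorem grStep_crossLab {i : ℕ} (hi : i + 1 < n) :
    D.grStep (D.crossLab S z i) =
      if ((S (z i)).up = true ↔ (S (z i)).pos < (S (z (i + 1))).pos) then 1 else -1 := by
  have h1 : D.nxt0 (D.spt (D.crossLab S z i)) =
      shift (D.pz * -((S (z i)).pos / D.pz)) 0 (D.norm (S (z (i + 1)))) := by
    rw [hS.spt_crossLab hz (by omega), hS.nxt0_shift hz (by omega), min_eq_left (by omega)]
  have h2 : D.TrueUp (D.spt (D.crossLab S z i)) ↔ (S (z i)).up = true := by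
    rw [hS.spt_crossLab hz (by omega), ← norm_shift, trueUp_norm]; rfl
  have h3 : (D.crossLab S z i : ℤ) < (D.nxt0 (D.spt (D.crossLab S z i))).pos ↔
      (S (z i)).pos < (S (z (i + 1))).pos := by
    rw [h1, natCast_crossLab]
    have := Int.emod_add_mul_ediv (S (z i)).pos D.pz
    simp only [shift, norm_pos, mul_neg]
    constructor <;> intro h <;> linarith
  rw [grStep, srcIsStart, h2, h3]
  split_ifs <;> rfl

theorem reachIn_iff {i j : ℕ} (hi : i < n) (hj : j < n) :
    D.ReachIn (D.crossLab S z i) (D.crossLab S z j) ↔ i ≤ j := by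
  constructor
  · rintro ⟨k, hk⟩
    rw [hS.labAt_crossLab hz hi, Nat.cast_inj] at hk
    have := hS.crossLab_inj hz (by omega) hj hk
    omega
  · intro h
    refine ⟨j - i, ?_⟩
    rw [hS.labAt_crossLab hz hi]
    congr 2
    omega

theorem pathSum_find {i j : ℕ} (hi : i < n) (hj : j < n)
    (h : D.ReachIn (D.crossLab S z i) (D.crossLab S z j)) (f : ℕ → ℤ) :
    D.pathSum f (D.crossLab S z i) (Nat.find h) =
      (∑ k ∈ Finset.range j, f (D.crossLab S z k)) -
        ∑ k ∈ Finset.range i, f (D.crossLab S z k) := by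
  have hij := (hS.reachIn_iff hz hi hj).1 h
  have hf : Nat.find h = j - i := by
    refine (Nat.find_eq_iff h).2 ⟨?_, ?_⟩
    · rw [hS.labAt_crossLab hz hi]
      congr 2
      omega
    · intro k hk e
      rw [hS.labAt_crossLab hz hi, Nat.cast_inj] at e
      have := hS.crossLab_inj hz (by omega) hj e
      omega
  rw [hf, pathSum]
  obtain ⟨d, rfl⟩ := Nat.exists_eq_add_of_le hij
  rw [Finset.sum_range_add, add_sub_cancel_left, Nat.add_sub_cancel_left]
  refine Finset.sum_congr rfl fun k hk => ?_
  rw [Finset.mem_range] at hk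
  rw [hS.labAt_crossLab hz hi, min_eq_left (by omega), Int.toNat_natCast]

theorem relOf_crossLab {i j : ℕ} (hi : i < n) (hj : j < n) (f : ℕ → ℤ) :
    D.relOf f (D.crossLab S z i) (D.crossLab S z j) =
      (∑ k ∈ Finset.range j, f (D.crossLab S z k)) -
        ∑ k ∈ Finset.range i, f (D.crossLab S z k) := by
  unfold relOf
  split_ifs with h h'
  · exact hS.pathSum_find hz hi hj h f
  · rw [hS.pathSum_find hz hj hi h' f, neg_sub]
  · rw [hS.reachIn_iff hz hi hj] at h
    rw [hS.reachIn_iff hz hj hi] at h'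
    omega

theorem reach_crossLab {i j : ℕ} (hij : i ≤ j) (hj : j < n) :
    D.Reach (D.crossLab S z i) (D.crossLab S z j) := by
  have h : z i ≤ z j := by
    rcases hij.eq_or_lt with rfl | h
    · rfl
    · exact (hz.lt i j h hj).le
  have e : z i + ((z j - z i).toNat : ℤ) = z j := by omega
  refine ⟨(z j - z i).toNat, ?_, ?_⟩
  · rw [hS.isCross0_iterate_spt hz (by omega), e]
    exact hz.isCross0 hj
  · rw [hS.spt_crossLab hz (by omega), hS.iterate_fstep_shift, e, natCast_crossLab]
    simp [shift]

theorem sameClass_iff {i b : ℕ} (hi : i < n) (hb : b < D.p) :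
    D.SameClass b (D.crossLab S z i) ↔ ∃ m < n, D.crossLab S z m = b := by
  constructor
  · have key : ∀ k : ℤ, IsCross0 (S k) → (S k).pos % D.pz = b →
        ∃ m < n, D.crossLab S z m = b := by
      intro k hk e
      obtain ⟨m, hm, rfl⟩ := (hz.iff k).1 hk
      exact ⟨m, hm, by rw [← natCast_crossLab] at e; exact_mod_cast e⟩
    rintro (⟨N, h1, h2⟩ | ⟨N, h1, h2⟩)
    · obtain ⟨j, hj, hjb⟩ := hS.cover b hb
      have hT := hS.translate j (-((S j).pos / D.pz)) (-(S j).ht)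
      have e : D.spt b = D.norm (shift (D.pz * -((S j).pos / D.pz)) (-(S j).ht) (S (0 + j))) := by
        rw [zero_add, hS.spt_eq hj hjb]
      rw [e, hT.iterate_fstep 0 N] at h1 h2
      rw [isCross0_norm] at h1
      rw [norm_pos] at h2
      simp only [IsCross0, shift, Int.add_mul_emod_self_left] at h1 h2
      rw [natCast_crossLab] at h2
      obtain ⟨k, hk⟩ := hS.dvd _ _ h1.1 (hz.isCross0 hi).1 h2
      have h3 := hS.add_period_mul (z i) k
      rw [← hk, add_sub_cancel] at h3
      have h4 := hS.add_period_mul j (-k)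
      have h5 : (S j).ht = H * k := by
        have := congrArg CState.ht h3
        simp only [shift, (hz.isCross0 hi).2] at this
        linarith [h1.2]
      refine key (j + L * -k) ?_ ?_
      · rw [h4]
        exact ⟨hj, by simp only [shift]; linarith⟩
      · rw [h4]
        simpa [shift] using hjb
    · rw [hS.isCross0_iterate_spt hz hi] at h1
      rw [hS.spt_crossLab hz hi, hS.iterate_fstep_shift] at h2
      exact key _ h1 (by simpa [shift] using h2)
  · rintro ⟨m, hm, rfl⟩
    rcases le_total m i with h | h
    · exact Or.inl (hS.reach_crossLab hz h hi)
    · exact Or.inr (hS.reach_crossLab hz h hm)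

end PeriodicLift

/-- The intersection points of the class of `c`, listed along the lift of `β`, form a meander,
whose grading is the relative Maslov grading. -/
theorem exists_meander (hconn : D.Connected) (hA : D.algInt ≠ 0) {c : ℕ} (hc : c < D.p) :
    ∃ (n : ℕ) (ℓ : ℕ → ℕ) (x γ : ℕ → ℤ) (κ : ℤ), Meander n x γ ∧
      (∀ m, ℓ m < D.p) ∧
      (∀ i j, i < n → j < n → ℓ i = ℓ j → i = j) ∧
      (∀ b < D.p, D.SameClass b c ↔ ∃ m < n, ℓ m = b) ∧
      (∀ m < n, D.grOf c (ℓ m) = γ m - κ) ∧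
      (∀ m < n, D.Returns0 (D.spt (ℓ m)) ↔ m + 1 < n) ∧
      (∀ m, m + 1 < n → D.lab (D.nxt0 (D.spt (ℓ m))) = ℓ (m + 1)) := by
  obtain ⟨S, L, X, H, hS, h0⟩ := D.exists_periodicLift_through hconn hA hc
  obtain ⟨n, z, hz⟩ := hS.isLift.exists_crossings
  obtain ⟨i, hi, hzi⟩ := (hz.iff 0).1 (by rw [h0, isCross0_norm]; exact ⟨rfl, rfl⟩)
  have hci : D.crossLab S z i = c := by
    have h1 := D.natCast_crossLab S z i
    rw [hzi, h0, norm_pos] at h1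
    have h2 : (D.spt c).pos % D.pz = c :=
      Int.emod_eq_of_lt (Int.natCast_nonneg c) (Int.ofNat_lt.2 hc)
    exact_mod_cast h1.trans h2
  refine ⟨n, D.crossLab S z, fun m => (S (z m)).pos,
    fun m => ∑ k ∈ Finset.range m, D.grStep (D.crossLab S z k),
    ∑ k ∈ Finset.range i, D.grStep (D.crossLab S z k),
    hS.isLift.meander hz (by omega) _ fun m hm => ?_, D.crossLab_lt S z,
    fun _ _ => hS.crossLab_inj hz, fun b hb => ?_, fun m hm => ?_,
    fun m hm => hS.returns0_iff hz hm, fun m hm => ?_⟩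
  · rw [Finset.sum_range_succ, hS.grStep_crossLab hz hm]
  · rw [← hci]
    exact hS.sameClass_iff hz hi hb
  · rw [← hci, grOf]
    exact hS.relOf_crossLab hz hi hm _
  · have := hS.labAt_crossLab hz (m := m) (by omega) 1
    rwa [min_eq_left (by omega)] at this

end

theorem grCountClass_eq {c n : ℕ} {ℓ : ℕ → ℕ} {γ : ℕ → ℤ} {κ : ℤ} (hlt : ∀ m, ℓ m < D.p)
    (hinj : ∀ i j, i < n → j < n → ℓ i = ℓ j → i = j)
    (hclass : ∀ b < D.p, D.SameClass b c ↔ ∃ m < n, ℓ m = b)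
    (hgr : ∀ m < n, D.grOf c (ℓ m) = γ m - κ) (g : ℤ) :
    D.grCountClass c g = {m ∈ Finset.range n | γ m = κ + g}.card := by
  symm
  refine Finset.card_bij (fun m _ => ℓ m) ?_ ?_ ?_
  · intro m hm
    rw [Finset.mem_filter, Finset.mem_range] at hm
    rw [Finset.mem_filter, Finset.mem_range, hclass _ (hlt m), hgr m hm.1]
    exact ⟨hlt m, ⟨m, hm.1, rfl⟩, by omega⟩
  · intro i hi j hj
    rw [Finset.mem_filter, Finset.mem_range] at hi hj
    exact hinj i j hi.1 hj.1
  · intro b hb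
    rw [Finset.mem_filter, Finset.mem_range] at hb
    obtain ⟨hb, hbc, hbg⟩ := hb
    obtain ⟨m, hm, rfl⟩ := (hclass b hb).1 hbc
    rw [hgr m hm] at hbg
    exact ⟨m, Finset.mem_filter.2 ⟨Finset.mem_range.2 hm, by omega⟩, rfl⟩

end StdDiagram

/-- Lemma 3.7, with the grading multiplicity hypothesis.  Suppose
the generators of the class of `c` occupy consecutive Maslov gradings with
multiplicities, from highest to lowest, of the form `(*,*,1)` or `(*,*,2,1)`.  Then
the unique generator of lowest Maslov grading has both a predecessor and a successor
along `β̃ₛ`. -/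
theorem lowest_grading_generator_has_predecessor_and_successor
    (D : StdDiagram) (hconn : D.Connected) (hA : D.algInt ≠ 0)
    (c : ℕ) (hc : c < D.p)
    (hpat : ∃ g0 : ℤ,
      (1 ≤ D.grCountClass c g0 ∧ 1 ≤ D.grCountClass c (g0 - 1) ∧
        D.grCountClass c (g0 - 2) = 1 ∧
        ∀ g, g ≠ g0 → g ≠ g0 - 1 → g ≠ g0 - 2 → D.grCountClass c g = 0) ∨
      (1 ≤ D.grCountClass c g0 ∧ 1 ≤ D.grCountClass c (g0 - 1) ∧
        D.grCountClass c (g0 - 2) = 2 ∧ D.grCountClass c (g0 - 3) = 1 ∧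
        ∀ g, g ≠ g0 → g ≠ g0 - 1 → g ≠ g0 - 2 → g ≠ g0 - 3 → D.grCountClass c g = 0)) :
    ∀ a : ℕ, a < D.p → D.SameClass a c →
      (∀ b : ℕ, b < D.p → D.SameClass b c → D.grOf c a ≤ D.grOf c b) →
      (D.Returns0 (D.spt a) ∧
        ∃ b : ℕ, b < D.p ∧ D.Returns0 (D.spt b) ∧ D.lab (D.nxt0 (D.spt b)) = (a : ℤ)) := by
  obtain ⟨n, ℓ, x, γ, κ, hM, hlt, hinj, hclass, hgr, hret, hnxt⟩ :=
    D.exists_meander hconn hA hc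
  have hcount := D.grCountClass_eq hlt hinj hclass hgr
  have hex : ∀ g, 1 ≤ D.grCountClass c g → ∃ m < n, γ m = κ + g := by
    intro g h
    rw [hcount, Nat.one_le_iff_ne_zero, Finset.card_ne_zero] at h
    obtain ⟨m, hm⟩ := h
    rw [Finset.mem_filter, Finset.mem_range] at hm
    exact ⟨m, hm⟩
  have hno : ∀ m < n, D.grCountClass c (γ m - κ) ≠ 0 := by
    intro m hm
    rw [hcount, Finset.card_ne_zero]
    exact ⟨m, by simp [hm]⟩
  have huniq : ∀ g, D.grCountClass c g = 1 → ∀ i j, i < n → j < n → γ i = κ + g →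
      γ j = κ + g → i = j := by
    intro g h i j hi hj ei ej
    rw [hcount] at h
    exact Finset.card_le_one.1 h.le i (by simp [hi, ei]) j (by simp [hj, ej])
  have htwo : ∀ g, D.grCountClass c g = 2 → ∀ i j k, i < n → j < n → k < n → i < j → j < k →
      γ i = κ + g → γ j = κ + g → γ k ≠ κ + g := by
    intro g h i j k hi hj hk hij hjk ei ej ek
    rw [hcount] at h
    have h3 : 2 < {m ∈ Finset.range n | γ m = κ + g}.card :=
      Finset.two_lt_card.2 ⟨i, by simp [hi, ei], j, by simp [hj, ej], k, by simp [hk, ek],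
        by omega, by omega, by omega⟩
    omega
  intro a ha hac hmin
  obtain ⟨m, hm, rfl⟩ := (hclass a ha).1 hac
  have hlow : ∀ i < n, γ m ≤ γ i := by
    intro i hi
    have := hmin (ℓ i) (hlt i) ((hclass _ (hlt i)).2 ⟨i, hi, rfl⟩)
    rw [hgr i hi, hgr m hm] at this
    omega
  suffices hint : 0 < m ∧ m + 1 < n by
    refine ⟨(hret m hm).2 hint.2, ℓ (m - 1), hlt _, (hret _ (by omega)).2 (by omega), ?_⟩
    rw [hnxt _ (by omega), Nat.sub_add_cancel hint.1]
  obtain ⟨g0, ⟨h0, h1, h2, hother⟩ | ⟨h0, h1, h2, h3, hother⟩⟩ := hpat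
  · obtain ⟨i0, hi0, e0⟩ := hex _ h0
    obtain ⟨i2, hi2, e2⟩ := hex _ h2.ge
    have hn : 1 < n := by
      have : i0 ≠ i2 := by rintro rfl; omega
      omega
    have hval : ∀ i < n, γ i = κ + g0 ∨ γ i = κ + g0 - 1 ∨ γ i = κ + g0 - 2 := by
      intro i hi
      by_contra hcon
      exact hno i hi (hother _ (by omega) (by omega) (by omega))
    have hg : γ m = κ + (g0 - 2) := by
      have := hval m hm
      have := hlow i2 hi2
      omega
    refine hM.interior_of_lowest_of_three hn (g := κ + (g0 - 2)) (fun i hi => ?_)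
      (fun i hi => ?_) hm hg fun i hi e => huniq _ h2 i m hi hm e hg
    · have := hlow i hi
      omega
    · have := hval i hi
      omega
  · obtain ⟨i0, hi0, e0⟩ := hex _ h0
    obtain ⟨i3, hi3, e3⟩ := hex _ h3.ge
    have hn : 1 < n := by
      have : i0 ≠ i3 := by rintro rfl; omega
      omega
    have hval : ∀ i < n, γ i = κ + g0 ∨ γ i = κ + g0 - 1 ∨ γ i = κ + g0 - 2 ∨
        γ i = κ + g0 - 3 := by
      intro i hi
      by_contra hcon
      exact hno i hi (hother _ (by omega) (by omega) (by omega) (by omega))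
    have hg : γ m = κ + (g0 - 3) := by
      have := hval m hm
      have := hlow i3 hi3
      omega
    have e2 : κ + (g0 - 2) = κ + (g0 - 3) + 1 := by ring
    refine hM.interior_of_lowest_of_four hn (g := κ + (g0 - 3)) (fun i hi => ?_)
      (fun i hi => ?_) (e2 ▸ htwo _ h2) hm hg fun i hi e => huniq _ h3 i m hi hm e hg
    · have := hlow i hi
      omega
    · have := hval i hi
      omega

end

end OneOneKnot
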